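/- arXiv:1403.6852 — 2 statements merged into one kernel-verified Lean document; each statement's English description precedes it below -/
import Mathlib

section
/- (Base locus of star linear systems.) Let k be an algebraically closed field of characteristic zero, n ≥ 2, and let d, m_1,…,m_{n+2} be integers with 0 ≤ m_i ≤ d for all i and Σ_{i=1}^{n+2} m_i ≤ (n+1)d. For I ⊆ {1,…,n+2} with 2 ≤ |I| ≤ n+1, let λ_I := ⋂_{l ∉ I} h_l (a linear subspace of dimension |I|−2) and k_I := max(Σ_{i∈I} m_i − (|I|−1)d, 0). Then the star configuration subspace λ_I is contained in the base locus of the star linear system Δ with multiplicity k_I: every F in Δ lies in I(λ_I)^{k_I}, and if Δ ≠ 0 then some F in Δ does not lie in I(λ_I)^{k_I + 1}. -/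
open MvPolynomial Finset

noncomputable section

/-- The homogeneous vanishing ideal of the point of `ℙ^{N-1}` represented by the
vector `v`: the ideal generated by the linear forms vanishing at `v`. -/
def pointIdeal (k : Type) [Field k] (N : ℕ) (v : Fin N → k) :
    Ideal (MvPolynomial (Fin N) k) :=
  Ideal.span {P | P ∈ homogeneousSubmodule (Fin N) k 1 ∧ eval v P = 0}

/-- The homogeneous vanishing ideal `(x_j : j ≠ i)` of the `i`-th coordinate point. -/
def coordIdeal (k : Type) [Field k] (N : ℕ) (i : ℕ) :
    Ideal (MvPolynomial (Fin N) k) :=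
  Ideal.span {P | ∃ j : Fin N, (j : ℕ) ≠ i ∧ P = X j}

/-- The linear system `L_{n,d}(m_1,…,m_s; p_1,…,p_s)` of degree-`d` forms in `n+1`
variables with multiplicity at least `m i` at the point `p i`, for `i < s`. -/
def linSys (k : Type) [Field k] (n d s : ℕ) (m : ℕ → ℕ)
    (p : ℕ → (Fin (n + 1) → k)) : Submodule k (MvPolynomial (Fin (n + 1)) k) :=
  (homogeneousSubmodule (Fin (n + 1)) k d) ⊓
    ⨅ i ∈ Finset.range s,
      Submodule.restrictScalars k (pointIdeal k (n + 1) (p i) ^ (m i))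

/-- The generic dimension of `L_{n,d}(m_1,…,m_s)`: the minimum over all `s`-tuples of
points of `ℙ^n(k)` of the dimension of the corresponding linear system. -/
def gdim (k : Type) [Field k] (n d s : ℕ) (m : ℕ → ℕ) : ℕ :=
  sInf {N | ∃ p : ℕ → (Fin (n + 1) → k),
    (∀ i < s, p i ≠ 0) ∧ N = Module.finrank k ↥(linSys k n d s m p)}

/-- `k_I = max(Σ_{i∈I} m_i − (|I|−1)d, 0)`. -/
def kIdx (d : ℕ) (m : ℕ → ℕ) (I : Finset ℕ) : ℤ :=
  max ((∑ i ∈ I, (m i : ℤ)) - ((I.card : ℤ) - 1) * d) 0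

/-- `binom(a, n)`, understood to be `0` whenever `a < n` (in particular for negative `a`). -/
def binomZ (a : ℤ) (n : ℕ) : ℤ :=
  if a < (n : ℤ) then 0 else ((a.toNat).choose n : ℤ)

/-- The (affine) linear virtual dimension
`ℓ(n,d;m_1,…,m_s) = Σ_{I ⊆ {1,…,s}} (−1)^{|I|} binom(n + k_I − |I|, n)`. -/
def ldim (n d s : ℕ) (m : ℕ → ℕ) : ℤ :=
  ∑ I ∈ (Finset.range s).powerset,
    (-1) ^ I.card * binomZ ((n : ℤ) + kIdx d m I - (I.card : ℤ)) n

/-- The vectors representing the `n+2` vertices: `e_l` for `l ≤ n+1` and the zero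
vector for `l = n+2`, so that `q_{ij} = [starVec i − starVec j]` is the star
configuration point for all `i < j`. -/
def starVec (k : Type) [Field k] (n : ℕ) (l : Fin (n + 2)) : Fin (n + 1) → k :=
  fun j => if (l : ℕ) = (j : ℕ) then 1 else 0

/-- The star linear system `Δ` attached to `(d; m_1,…,m_{n+2})`. -/
def starSys (k : Type) [Field k] (n d : ℕ) (m : Fin (n + 2) → ℕ) :
    Submodule k (MvPolynomial (Fin (n + 1)) k) :=
  (homogeneousSubmodule (Fin (n + 1)) k d) ⊓
    ⨅ (i : Fin (n + 2)) (j : Fin (n + 2)) (_ : i < j),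
      Submodule.restrictScalars k
        (pointIdeal k (n + 1) (starVec k n i - starVec k n j) ^ (m i + m j - d))

/-- The linear form defining the hyperplane `h_l`: `y_l` for `l ≤ n+1` and
`y_1 + ⋯ + y_{n+1}` for `l = n+2`. -/
def starForm (k : Type) [Field k] (n : ℕ) (l : Fin (n + 2)) :
    MvPolynomial (Fin (n + 1)) k :=
  if h : (l : ℕ) < n + 1 then X ⟨(l : ℕ), h⟩ else ∑ j, X j

/-- The homogeneous vanishing ideal of the star configuration subspace
`λ_I = ⋂_{l ∉ I} h_l`, generated by the defining forms of the hyperplanes `h_l`,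
`l ∉ I`. -/
def starSubIdeal (k : Type) [Field k] (n : ℕ) (I : Finset (Fin (n + 2))) :
    Ideal (MvPolynomial (Fin (n + 1)) k) :=
  Ideal.span {P | ∃ l ∉ I, P = starForm k n l}

/-- The linear forms `h_1, …, h_{n+2}` normalised so that they sum to zero. -/
def starCoord (k : Type) [Field k] (n : ℕ) : Fin (n + 2) → MvPolynomial (Fin (n + 1)) k :=
  Fin.snoc (α := fun _ => MvPolynomial (Fin (n + 1)) k) X (-∑ j, X j)

section StarCoord

variable {k : Type} [Field k] {n : ℕ}

@[simp] lemma starCoord_castSucc (i : Fin (n + 1)) : starCoord k n i.castSucc = X i := by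
  simp [starCoord]

@[simp] lemma starCoord_last : starCoord k n (Fin.last (n + 1)) = -∑ j, X j := by
  simp [starCoord]

lemma sum_starCoord : ∑ l, starCoord k n l = 0 := by
  simp [Fin.sum_univ_castSucc]

lemma starForm_castSucc (i : Fin (n + 1)) : starForm k n i.castSucc = starCoord k n i.castSucc := by
  have h : ((i.castSucc : Fin (n + 2)) : ℕ) < n + 1 := i.isLt
  rw [starForm, dif_pos h, starCoord_castSucc]
  rfl

lemma starForm_last : starForm k n (Fin.last (n + 1)) = -starCoord k n (Fin.last (n + 1)) := by
  simp [starForm]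

lemma starSubIdeal_le_iff {I : Finset (Fin (n + 2))} {K : Ideal (MvPolynomial (Fin (n + 1)) k)} :
    starSubIdeal k n I ≤ K ↔ ∀ l ∉ I, starCoord k n l ∈ K := by
  have key : ∀ l, starForm k n l ∈ K ↔ starCoord k n l ∈ K := by
    intro l
    induction l using Fin.lastCases with
    | last => rw [starForm_last, neg_mem_iff]
    | cast i => rw [starForm_castSucc]
  rw [starSubIdeal, Ideal.span_le]
  constructor
  · exact fun h l hl => (key l).1 (h ⟨l, hl, rfl⟩)
  · rintro h _ ⟨l, hl, rfl⟩
    exact (key l).2 (h l hl)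

lemma starCoord_mem_starSubIdeal {I : Finset (Fin (n + 2))} {l : Fin (n + 2)} (hl : l ∉ I) :
    starCoord k n l ∈ starSubIdeal k n I :=
  starSubIdeal_le_iff.1 le_rfl l hl

lemma isHomogeneous_starCoord (l : Fin (n + 2)) : (starCoord k n l).IsHomogeneous 1 := by
  induction l using Fin.lastCases with
  | last =>
    rw [starCoord_last]
    exact (IsHomogeneous.sum _ _ _ fun j _ => isHomogeneous_X _ _).neg
  | cast i => rw [starCoord_castSucc]; exact isHomogeneous_X _ _

lemma aeval_starCoord {S : Type*} [CommRing S] [Algebra k S] {u : Fin (n + 2) → S}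
    (hu : ∑ l, u l = 0) (l : Fin (n + 2)) :
    aeval (fun i : Fin (n + 1) => u i.castSucc) (starCoord k n l) = u l := by
  induction l using Fin.lastCases with
  | last =>
    rw [Fin.sum_univ_castSucc] at hu
    simp only [starCoord_last, map_neg, map_sum, aeval_X]
    exact neg_eq_of_add_eq_zero_right hu
  | cast i => simp

lemma starVec_castSucc_apply (i j : Fin (n + 1)) :
    starVec k n i.castSucc j = if i = j then 1 else 0 := by
  simp [starVec, Fin.ext_iff]

lemma starVec_last : starVec k n (Fin.last (n + 1)) = 0 := by
  ext j
  have := j.isLt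
  simp only [starVec, Fin.val_last, Pi.zero_apply, ite_eq_right_iff]
  omega

lemma eval_starVec_sub_starCoord {i j l : Fin (n + 2)} (hi : l ≠ i) (hj : l ≠ j) :
    eval (starVec k n i - starVec k n j) (starCoord k n l) = 0 := by
  have key : ∀ a : Fin (n + 2), l ≠ a → eval (starVec k n a) (starCoord k n l) =
      if l = Fin.last (n + 1) then -1 else 0 := by
    intro a ha
    induction l using Fin.lastCases with
    | last =>
      induction a using Fin.lastCases with
      | last => exact absurd rfl ha
      | cast a => simp [starVec_castSucc_apply]
    | cast l =>
      induction a using Fin.lastCases with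
      | last => simp [starVec_last]
      | cast a =>
        have : a ≠ l := fun h => ha (by rw [h])
        simp [starVec_castSucc_apply, this]
  have hlin : eval (starVec k n i - starVec k n j) (starCoord k n l) =
      eval (starVec k n i) (starCoord k n l) - eval (starVec k n j) (starCoord k n l) := by
    induction l using Fin.lastCases with
    | last => simp; ring
    | cast l => simp
  rw [hlin, key i hi, key j hj, sub_self]

lemma starCoord_mem_pointIdeal {i j l : Fin (n + 2)} (hi : l ≠ i) (hj : l ≠ j) :
    starCoord k n l ∈ pointIdeal k (n + 1) (starVec k n i - starVec k n j) :=
  Ideal.subset_span ⟨isHomogeneous_starCoord l, eval_starVec_sub_starCoord hi hj⟩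

lemma exists_eq_sum_starCoord {P : MvPolynomial (Fin (n + 1)) k} (hP : P.IsHomogeneous 1) :
    ∃ c : Fin (n + 2) → k, c (Fin.last _) = 0 ∧ P = ∑ l, C (c l) * starCoord k n l := by
  rw [← mem_homogeneousSubmodule, homogeneousSubmodule_one_eq_span_X,
    Submodule.mem_span_range_iff_exists_fun] at hP
  obtain ⟨c, rfl⟩ := hP
  refine ⟨Fin.snoc (α := fun _ => k) c 0, by simp, ?_⟩
  simp [Fin.sum_univ_castSucc, smul_eq_C_mul]

lemma pointIdeal_le_starSubIdeal {i j : Fin (n + 2)} (hij : i ≠ j) :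
    pointIdeal k (n + 1) (starVec k n i - starVec k n j) ≤ starSubIdeal k n {i, j} := by
  refine Ideal.span_le.2 ?_
  rintro P ⟨hP, hev⟩
  obtain ⟨c, hc, rfl⟩ := exists_eq_sum_starCoord hP
  have hev' : c i = c j := by
    have key : ∀ a, (∑ l, C (c l) * starCoord k n l).eval (starVec k n a) = c a := by
      intro a
      induction a using Fin.lastCases with
      | last => simp [Fin.sum_univ_castSucc, starVec_last, hc]
      | cast a =>
        rw [Fin.sum_univ_castSucc]
        simp [starVec_castSucc_apply, hc]
    rw [← key i, ← key j, ← sub_eq_zero, ← hev, Fin.sum_univ_castSucc]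
    simp only [hc, starCoord_castSucc, map_sum, map_mul, eval_C, eval_X, map_zero,
      zero_mul, add_zero, Pi.sub_apply, mul_sub, sum_sub_distrib]
  have hsum : ∑ l, C (c l) * starCoord k n l = ∑ l, C (c l - c i) * starCoord k n l := by
    simp only [C_sub, sub_mul, sum_sub_distrib, ← mul_sum, sum_starCoord, mul_zero, sub_zero]
  rw [hsum]
  refine Ideal.sum_mem _ fun l _ => ?_
  by_cases hl : l ∈ ({i, j} : Finset (Fin (n + 2)))
  · have : c l = c i := by
      rcases Finset.mem_insert.1 hl with rfl | h
      · rfl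
      · rw [Finset.mem_singleton.1 h, hev']
    simp [this]
  · exact Ideal.mul_mem_left _ _ (starCoord_mem_starSubIdeal hl)

end StarCoord

section IteratedPolynomial

variable {σ τ : Type*}

lemma pow_dvd_coeff_of_mem_pow {A : Type*} [CommRing A] (g : A) {s : ℕ}
    {F : MvPolynomial σ A} (hF : F ∈ (idealOfVars σ A ⊔ Ideal.span {C g}) ^ s) (α : σ →₀ ℕ) :
    g ^ (s - α.degree) ∣ coeff α F := by
  classical
  induction s generalizing F α with
  | zero => simp
  | succ s ih =>
    rw [pow_succ] at hF
    refine Submodule.mul_induction_on hF (fun P hP Q hQ => ?_) (fun P Q hP hQ => ?_)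
    · have hQ' : ∀ β : σ →₀ ℕ, g ^ (1 - β.degree) ∣ coeff β Q := by
        intro β
        by_cases hβ : β = 0
        · subst hβ
          obtain ⟨x, hx, y, hy, rfl⟩ := Submodule.mem_sup.1 hQ
          obtain ⟨z, rfl⟩ := Ideal.mem_span_singleton'.1 hy
          have hx0 : coeff 0 x = 0 :=
            (mem_pow_idealOfVars_iff' 1 x).1 (by rwa [pow_one]) 0 (by simp)
          rw [coeff_add, hx0, zero_add, mul_comm, coeff_C_mul]
          simp
        · have : β.degree ≠ 0 := by rwa [Ne, Finsupp.degree_eq_zero_iff]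
          rw [Nat.sub_eq_zero_of_le (by omega), pow_zero]
          exact one_dvd _
      rw [coeff_mul]
      refine Finset.dvd_sum fun x hx => ?_
      have hdeg : x.1.degree + x.2.degree = α.degree := by
        rw [← map_add, Finset.HasAntidiagonal.mem_antidiagonal.1 hx]
      refine dvd_trans (pow_dvd_pow g ?_) ((pow_add g _ _) ▸ mul_dvd_mul (ih hP x.1) (hQ' x.2))
      omega
    · rw [coeff_add]
      exact dvd_add hP hQ

/-- Polynomials over a polynomial ring whose degree in both sets of variables together is
at most `d`. -/
def jointDegreeLE (σ τ k : Type*) [Field k] (d : ℕ) :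
    Submodule k (MvPolynomial σ (MvPolynomial τ k)) where
  carrier := {P | ∀ α, coeff α P ≠ 0 → (coeff α P).totalDegree + α.degree ≤ d}
  zero_mem' := by simp
  add_mem' {P Q} hP hQ := by
    intro α hα
    by_cases h1 : coeff α P = 0
    · rw [coeff_add, h1, zero_add] at hα ⊢
      exact hQ α hα
    by_cases h2 : coeff α Q = 0
    · rw [coeff_add, h2, add_zero] at hα ⊢
      exact hP α hα
    have := hP α h1
    have := hQ α h2
    have := totalDegree_add (coeff α P) (coeff α Q)
    rw [coeff_add]
    omega
  smul_mem' c P hP := by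
    intro α hα
    have h1 : coeff α P ≠ 0 := by
      intro h
      exact hα (by rw [coeff_smul, h, smul_zero])
    have := hP α h1
    have := totalDegree_smul_le c (coeff α P)
    rw [coeff_smul]
    omega

variable {k : Type*} [Field k]

lemma jointDegreeLE_mul_le (d e : ℕ) :
    jointDegreeLE σ τ k d * jointDegreeLE σ τ k e ≤ jointDegreeLE σ τ k (d + e) := by
  classical
  refine Submodule.mul_le.2 fun P hP Q hQ α hα => ?_
  have hterm : ∀ x ∈ antidiagonal α, coeff x.1 P * coeff x.2 Q ≠ 0 →
      (coeff x.1 P * coeff x.2 Q).totalDegree + α.degree ≤ d + e := by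
    intro x hx hne
    have := hP x.1 (left_ne_zero_of_mul hne)
    have := hQ x.2 (right_ne_zero_of_mul hne)
    have := totalDegree_mul (coeff x.1 P) (coeff x.2 Q)
    rw [← Finset.HasAntidiagonal.mem_antidiagonal.1 hx, map_add]
    omega
  rw [coeff_mul] at hα ⊢
  obtain ⟨y, hy, hyne⟩ := Finset.exists_ne_zero_of_sum_ne_zero hα
  have hle := hterm y hy hyne
  suffices h : (∑ x ∈ antidiagonal α, coeff x.1 P * coeff x.2 Q).totalDegree ≤
      d + e - α.degree by omega
  refine totalDegree_finsetSum_le fun x hx => ?_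
  by_cases hx0 : coeff x.1 P * coeff x.2 Q = 0
  · simp [hx0]
  · have := hterm x hx hx0
    omega

lemma jointDegreeLE_one_pow_le (d : ℕ) :
    jointDegreeLE σ τ k 1 ^ d ≤ jointDegreeLE σ τ k d := by
  classical
  induction d with
  | zero =>
    rw [pow_zero, Submodule.one_le]
    intro α
    rw [coeff_one]
    split_ifs with h
    · simp [← h]
    · simp
  | succ d ih =>
    rw [pow_succ]
    exact (mul_le_mul_left ih _).trans (jointDegreeLE_mul_le d 1)

lemma X_mem_jointDegreeLE (i : σ) : X i ∈ jointDegreeLE σ τ k 1 := by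
  classical
  intro α
  rw [coeff_X]
  split_ifs with h
  · simp [← h]
  · simp

lemma C_X_mem_jointDegreeLE (i : τ) : C (X i) ∈ jointDegreeLE σ τ k 1 := by
  classical
  intro α
  rw [coeff_C]
  split_ifs with h
  · simp [← h]
  · simp

lemma aeval_mem_jointDegreeLE {ι : Type*} {w : ι → MvPolynomial σ (MvPolynomial τ k)}
    (hw : ∀ i, w i ∈ jointDegreeLE σ τ k 1) {d : ℕ} {F : MvPolynomial ι k}
    (hF : F.IsHomogeneous d) : aeval w F ∈ jointDegreeLE σ τ k d := by
  rw [← mem_homogeneousSubmodule, ← homogeneousSubmodule_one_pow] at hF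
  have h := Submodule.mem_map_of_mem (f := (aeval w).toLinearMap) hF
  rw [Submodule.map_pow] at h
  have hle : (homogeneousSubmodule ι k 1).map (aeval w).toLinearMap ≤ jointDegreeLE σ τ k 1 := by
    rw [homogeneousSubmodule_one_eq_span_X, Submodule.map_span, Submodule.span_le]
    rintro _ ⟨_, ⟨i, rfl⟩, rfl⟩
    simpa using hw i
  exact jointDegreeLE_one_pow_le d (pow_le_pow_left' hle d h)

end IteratedPolynomial

section Step

variable {k : Type} [Field k] {n : ℕ}

/-- The equation of `λ_{I ∖ i}` inside `λ_I`, in the coordinates `h_l`, `l ∈ I ∖ i₀`. -/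
def facetForm (k : Type) [Field k] (I : Finset (Fin (n + 2))) (i₀ i : Fin (n + 2)) :
    MvPolynomial (Fin (n + 2)) k :=
  if i = i₀ then ∑ j ∈ I.erase i₀, X j else X i

lemma isHomogeneous_facetForm (I : Finset (Fin (n + 2))) (i₀ i : Fin (n + 2)) :
    (facetForm k I i₀ i).IsHomogeneous 1 := by
  rw [facetForm]
  split_ifs
  · exact IsHomogeneous.sum _ _ _ fun j _ => isHomogeneous_X _ _
  · exact isHomogeneous_X _ _

lemma not_X_dvd_sum_X {σ : Type*} {s : Finset σ} (hs : 2 ≤ s.card) (i : σ) :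
    ¬ (X i : MvPolynomial σ k) ∣ ∑ j ∈ s, X j := by
  classical
  rintro ⟨P, hP⟩
  obtain ⟨j, hj, hji⟩ := Finset.exists_mem_ne (by omega : 1 < s.card) i
  have := congrArg (eval (Pi.single j (1 : k))) hP
  simp [Pi.single_apply, hj, hji.symm] at this

lemma isRelPrime_facetForm {I : Finset (Fin (n + 2))} (hI : 3 ≤ I.card) {i₀ i j : Fin (n + 2)}
    (h₀ : i₀ ∈ I) (hij : i ≠ j) : IsRelPrime (facetForm k I i₀ i) (facetForm k I i₀ j) := by
  have hcard : 2 ≤ (I.erase i₀).card := by rw [card_erase_of_mem h₀]; omega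
  have hX : ∀ l : Fin (n + 2), Irreducible (X l : MvPolynomial (Fin (n + 2)) k) :=
    fun l => X_prime.irreducible
  by_cases hi : i = i₀
  · have hj : j ≠ i₀ := fun h => hij (hi.trans h.symm)
    simp only [facetForm, if_pos hi, if_neg hj]
    exact ((hX j).isRelPrime_iff_not_dvd.2 (not_X_dvd_sum_X hcard j)).symm
  · by_cases hj : j = i₀
    · simp only [facetForm, if_neg hi, if_pos hj]
      exact (hX i).isRelPrime_iff_not_dvd.2 (not_X_dvd_sum_X hcard i)
    · simp only [facetForm, if_neg hi, if_neg hj]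
      exact (hX i).isRelPrime_iff_not_dvd.2 (by rw [X_dvd_X]; exact hij)

lemma facetForm_ne_zero {I : Finset (Fin (n + 2))} (hI : 3 ≤ I.card) {i₀ i : Fin (n + 2)}
    (h₀ : i₀ ∈ I) : facetForm k I i₀ i ≠ 0 := by
  have hcard : 2 ≤ (I.erase i₀).card := by rw [card_erase_of_mem h₀]; omega
  rw [facetForm]
  split_ifs
  · exact fun h => not_X_dvd_sum_X hcard i₀ (h ▸ dvd_zero _)
  · exact X_ne_zero i

/-- The forms `h_l` in coordinates adapted to `λ_I`: the outer variables are normal to `λ_I`,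
the inner ones are coordinates on `λ_I`, and `h_{i₀}` is eliminated. -/
def adaptedCoord (k : Type) [Field k] (I : Finset (Fin (n + 2))) (i₀ l : Fin (n + 2)) :
    MvPolynomial (Fin (n + 2)) (MvPolynomial (Fin (n + 2)) k) :=
  if l = i₀ then -(∑ j ∈ univ \ I, X j + C (∑ j ∈ I.erase i₀, X j))
  else if l ∈ I then C (X l) else X l

lemma adaptedCoord_of_notMem {I : Finset (Fin (n + 2))} {i₀ l : Fin (n + 2)} (h₀ : i₀ ∈ I)
    (hl : l ∉ I) : adaptedCoord k I i₀ l = X l := by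
  have : l ≠ i₀ := fun h => hl (h ▸ h₀)
  simp [adaptedCoord, this, hl]

lemma adaptedCoord_of_mem {I : Finset (Fin (n + 2))} {i₀ l : Fin (n + 2)} (hl : l ∈ I.erase i₀) :
    adaptedCoord k I i₀ l = C (X l) := by
  simp [adaptedCoord, mem_of_mem_erase hl, ne_of_mem_erase hl]

lemma adaptedCoord_self (I : Finset (Fin (n + 2))) (i₀ : Fin (n + 2)) :
    adaptedCoord k I i₀ i₀ = -(∑ j ∈ univ \ I, X j + C (∑ j ∈ I.erase i₀, X j)) := by
  simp [adaptedCoord]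

lemma sum_adaptedCoord {I : Finset (Fin (n + 2))} {i₀ : Fin (n + 2)} (h₀ : i₀ ∈ I) :
    ∑ l, adaptedCoord k I i₀ l = 0 := by
  rw [← sum_sdiff (subset_univ I), ← add_sum_erase I _ h₀, adaptedCoord_self,
    sum_congr rfl fun l hl => adaptedCoord_of_notMem h₀ (mem_sdiff.1 hl).2,
    sum_congr (s₁ := I.erase i₀) rfl fun l hl => adaptedCoord_of_mem hl, map_sum]
  ring

lemma adaptedCoord_mem_jointDegreeLE (I : Finset (Fin (n + 2))) (i₀ l : Fin (n + 2)) :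
    adaptedCoord k I i₀ l ∈ jointDegreeLE (Fin (n + 2)) (Fin (n + 2)) k 1 := by
  rw [adaptedCoord]
  split_ifs
  · rw [map_sum]
    exact neg_mem (add_mem (sum_mem fun j _ => X_mem_jointDegreeLE j)
      (sum_mem fun j _ => C_X_mem_jointDegreeLE j))
  · exact C_X_mem_jointDegreeLE l
  · exact X_mem_jointDegreeLE l

lemma adaptedCoord_mem_sup {I : Finset (Fin (n + 2))} {i₀ i l : Fin (n + 2)} (h₀ : i₀ ∈ I)
    (hl : l ∉ I.erase i) :
    adaptedCoord k I i₀ l ∈ idealOfVars (Fin (n + 2)) (MvPolynomial (Fin (n + 2)) k) ⊔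
      Ideal.span {C (facetForm k I i₀ i)} := by
  have hX : ∀ j, X j ∈ idealOfVars (Fin (n + 2)) (MvPolynomial (Fin (n + 2)) k) :=
    fun j => Ideal.subset_span ⟨j, rfl⟩
  have hC := Ideal.mem_span_singleton_self (C (σ := Fin (n + 2)) (facetForm k I i₀ i))
  by_cases hlI : l ∈ I
  · obtain rfl : l = i := by
      by_contra h
      exact hl (mem_erase.2 ⟨h, hlI⟩)
    by_cases hl0 : l = i₀
    · subst hl0
      rw [adaptedCoord_self]
      refine neg_mem (add_mem (Ideal.mem_sup_left (sum_mem fun j _ => hX j))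
        (Ideal.mem_sup_right ?_))
      simpa only [facetForm, if_true] using hC
    · rw [adaptedCoord_of_mem (mem_erase.2 ⟨hl0, hlI⟩)]
      refine Ideal.mem_sup_right ?_
      simpa only [facetForm, if_neg hl0] using hC
  · rw [adaptedCoord_of_notMem h₀ hlI]
    exact Ideal.mem_sup_left (hX l)

lemma mem_starSubIdeal_pow_of_adapted {I : Finset (Fin (n + 2))} {i₀ : Fin (n + 2)} (h₀ : i₀ ∈ I)
    {t : ℕ} {F : MvPolynomial (Fin (n + 1)) k}
    (hF : aeval (fun i => adaptedCoord k I i₀ (Fin.castSucc i)) F ∈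
      idealOfVars (Fin (n + 2)) (MvPolynomial (Fin (n + 2)) k) ^ t) :
    F ∈ starSubIdeal k n I ^ t := by
  let Φ : MvPolynomial (Fin (n + 2)) (MvPolynomial (Fin (n + 2)) k) →+*
      MvPolynomial (Fin (n + 1)) k :=
    eval₂Hom (aeval (starCoord k n) : MvPolynomial (Fin (n + 2)) k →ₐ[k] _).toRingHom
      (fun l => if l ∈ I then 0 else starCoord k n l)
  have hΦX : ∀ l ∉ I, Φ (X l) = starCoord k n l := fun l hl => by simp [Φ, hl]
  have hΦC : ∀ P, Φ (C P) = aeval (starCoord k n) P := fun P => by simp [Φ]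
  have hΦ : ∀ l, Φ (adaptedCoord k I i₀ l) = starCoord k n l := by
    intro l
    by_cases hl : l ∈ I
    · by_cases hl0 : l = i₀
      · subst hl0
        rw [adaptedCoord_self, map_neg, map_add, map_sum, hΦC, map_sum,
          sum_congr rfl fun l hl => hΦX l (mem_sdiff.1 hl).2, neg_eq_iff_add_eq_zero]
        simp only [aeval_X]
        rw [← sum_starCoord (k := k) (n := n), ← sum_sdiff (subset_univ I),
          ← add_sum_erase I _ hl]
        ring
      · rw [adaptedCoord_of_mem (mem_erase.2 ⟨hl0, hl⟩), hΦC, aeval_X]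
    · rw [adaptedCoord_of_notMem h₀ hl, hΦX l hl]
  have hcomp : Φ (aeval (fun i => adaptedCoord k I i₀ (Fin.castSucc i)) F) = F := by
    refine RingHom.congr_fun (f := Φ.comp (aeval _).toRingHom) (g := RingHom.id _) ?_ F
    refine ringHom_ext (fun r => ?_) fun i => ?_
    · simp [Φ, IsScalarTower.algebraMap_apply k (MvPolynomial (Fin (n + 2)) k)
        (MvPolynomial (Fin (n + 2)) (MvPolynomial (Fin (n + 2)) k))]
    · simp [hΦ]
  have hmap : (idealOfVars (Fin (n + 2)) (MvPolynomial (Fin (n + 2)) k)).map Φ ≤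
      starSubIdeal k n I := by
    rw [Ideal.map_le_iff_le_comap, idealOfVars, Ideal.span_le]
    rintro _ ⟨l, rfl⟩
    by_cases hl : l ∈ I
    · simp [Φ, hl]
    · simpa [Φ, hl] using starCoord_mem_starSubIdeal hl
  rw [← hcomp]
  refine Ideal.pow_right_mono hmap t ?_
  rw [← Ideal.map_pow]
  exact Ideal.mem_map_of_mem Φ hF

/-- Multiplicity along the facets `λ_{I ∖ i}` forces multiplicity along `λ_I`. -/
lemma mem_starSubIdeal_pow_of_erase {d : ℕ} {b : Fin (n + 2) → ℕ} {I : Finset (Fin (n + 2))}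
    (hI : 3 ≤ I.card) {F : MvPolynomial (Fin (n + 1)) k} (hF : F.IsHomogeneous d)
    (h : ∀ i ∈ I, F ∈ starSubIdeal k n (I.erase i) ^ (d - ∑ j ∈ I.erase i, b j)) :
    F ∈ starSubIdeal k n I ^ (d - ∑ j ∈ I, b j) := by
  obtain ⟨i₀, h₀⟩ : I.Nonempty := card_pos.1 (by omega)
  refine mem_starSubIdeal_pow_of_adapted h₀ ((mem_pow_idealOfVars_iff' _ _).2 fun α hα => ?_)
  by_contra hne
  have hdeg := aeval_mem_jointDegreeLE
    (fun i => adaptedCoord_mem_jointDegreeLE I i₀ (Fin.castSucc i)) hF α hne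
  set Ψ : MvPolynomial (Fin (n + 1)) k →ₐ[k] _ :=
    aeval (fun i => adaptedCoord k I i₀ (Fin.castSucc i)) with hΨ
  have hdvd : ∀ i ∈ I,
      facetForm k I i₀ i ^ ((d - ∑ j ∈ I.erase i, b j) - α.degree) ∣ coeff α (Ψ F) := by
    intro i hi
    refine pow_dvd_coeff_of_mem_pow _ ?_ α
    have hle : (starSubIdeal k n (I.erase i)).map Ψ.toRingHom ≤ _ :=
      Ideal.map_le_iff_le_comap.2 (starSubIdeal_le_iff.2 fun l hl => by
        rw [Ideal.mem_comap]
        change Ψ (starCoord k n l) ∈ _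
        rw [hΨ, aeval_starCoord (sum_adaptedCoord h₀)]
        exact adaptedCoord_mem_sup h₀ hl)
    refine Ideal.pow_right_mono hle _ ?_
    rw [← Ideal.map_pow]
    exact Ideal.mem_map_of_mem Ψ.toRingHom (h i hi)
  have hprod := Finset.prod_dvd_of_isRelPrime
    (fun i _ j _ hij => (isRelPrime_facetForm hI h₀ hij).pow) hdvd
  have hprod_deg : (∏ i ∈ I, facetForm k I i₀ i ^
      ((d - ∑ j ∈ I.erase i, b j) - α.degree)).totalDegree =
      ∑ i ∈ I, ((d - ∑ j ∈ I.erase i, b j) - α.degree) := by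
    refine IsHomogeneous.totalDegree (IsHomogeneous.prod _ _ _ fun i _ => ?_)
      (prod_ne_zero_iff.2 fun i _ => pow_ne_zero _ (facetForm_ne_zero hI h₀))
    simpa using (isHomogeneous_facetForm I i₀ i).pow ((d - ∑ j ∈ I.erase i, b j) - α.degree)
  have hle := totalDegree_le_of_dvd_of_isDomain hprod hne
  rw [hprod_deg] at hle
  have hexp : ∀ i ∈ I, (d - ∑ j ∈ I.erase i, b j) - α.degree =
      (d - ∑ j ∈ I, b j - α.degree) + b i := by
    intro i hi
    have := add_sum_erase I b hi
    omega
  rw [sum_congr rfl hexp, sum_add_distrib, sum_const, smul_eq_mul] at hle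
  have hmul : 3 * (d - ∑ j ∈ I, b j - α.degree) ≤ I.card * (d - ∑ j ∈ I, b j - α.degree) :=
    Nat.mul_le_mul_right _ hI
  omega

lemma mem_starSubIdeal_pow {d : ℕ} {b : Fin (n + 2) → ℕ} {F : MvPolynomial (Fin (n + 1)) k}
    (hF : F.IsHomogeneous d)
    (h : ∀ i j, i < j → F ∈ pointIdeal k (n + 1) (starVec k n i - starVec k n j) ^
      (d - (b i + b j))) (I : Finset (Fin (n + 2))) (hI : 2 ≤ I.card) :
    F ∈ starSubIdeal k n I ^ (d - ∑ j ∈ I, b j) := by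
  induction I using Finset.strongInduction with
  | H I ih =>
    rcases hI.eq_or_lt with hI2 | hI3
    · obtain ⟨i, j, hij, rfl⟩ := card_eq_two.1 hI2.symm
      rw [sum_pair hij]
      rcases hij.lt_or_gt with hlt | hlt
      · exact Ideal.pow_right_mono (pointIdeal_le_starSubIdeal hij) _ (h i j hlt)
      · rw [pair_comm, add_comm (b i)]
        exact Ideal.pow_right_mono (pointIdeal_le_starSubIdeal hij.symm) _ (h j i hlt)
    · refine mem_starSubIdeal_pow_of_erase hI3 hF fun i hi => ih _ (erase_ssubset hi) ?_
      rw [card_erase_of_mem hi]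
      omega

end Step

section Monomial

variable {k : Type} [Field k] {n : ℕ}

lemma prod_starCoord_mem_pow {K : Ideal (MvPolynomial (Fin (n + 1)) k)} {I : Finset (Fin (n + 2))}
    (hK : ∀ l ∉ I, starCoord k n l ∈ K) (a : Fin (n + 2) → ℕ) :
    ∏ l, starCoord k n l ^ a l ∈ K ^ (∑ l, a l - ∑ l ∈ I, a l) := by
  have hsum := sum_sdiff (f := a) (subset_univ I)
  have hexp : ∑ l, a l - ∑ l ∈ I, a l = ∑ l ∈ univ \ I, a l := by omega
  rw [hexp, ← prod_sdiff (subset_univ I), ← prod_pow_eq_pow_sum]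
  exact Ideal.mul_mem_right _ _ (Ideal.prod_mem_prod fun l hl =>
    Ideal.pow_mem_pow (hK l (mem_sdiff.1 hl).2) _)

lemma prod_starCoord_notMem_pow [CharZero k] {I : Finset (Fin (n + 2))} (hI : 2 ≤ I.card)
    (a : Fin (n + 2) → ℕ) :
    ∏ l, starCoord k n l ^ a l ∉ starSubIdeal k n I ^ (∑ l, a l - ∑ l ∈ I, a l + 1) := by
  obtain ⟨i₀, h₀⟩ : I.Nonempty := card_pos.1 (by omega)
  let T : Polynomial k := Polynomial.X
  let v : Fin (n + 2) → Polynomial k := fun l => if l ∈ I then 1 else T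
  let u : Fin (n + 2) → Polynomial k :=
    fun l => if l = i₀ then -∑ j ∈ univ.erase i₀, v j else v l
  have hu : ∑ l, u l = 0 := by
    rw [← add_sum_erase univ u (mem_univ i₀),
      sum_congr (s₁ := univ.erase i₀) rfl fun l hl => if_neg (ne_of_mem_erase hl)]
    simp [u]
  have huI : ∀ l ∉ I, u l = T := fun l hl => by
    have : l ≠ i₀ := fun h => hl (h ▸ h₀)
    simp [u, v, this, hl]
  have hu0 : ∀ l ∈ I, (u l).eval 0 ≠ 0 := by
    intro l hl
    by_cases hl0 : l = i₀
    · have hv : ∀ j, (v j).eval 0 = if j ∈ I then 1 else 0 := fun j => by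
        by_cases hj : j ∈ I <;> simp [v, hj, T]
      simp only [u, if_pos hl0, Polynomial.eval_neg, Polynomial.eval_finsetSum, hv, sum_boole,
        neg_ne_zero, Nat.cast_ne_zero, ← Nat.pos_iff_ne_zero, card_pos]
      obtain ⟨j, hj, hji⟩ := Finset.exists_mem_ne (by omega : 1 < I.card) i₀
      exact ⟨j, by simp [hj, hji]⟩
    · simp [u, v, hl0, hl]
  intro hmem
  set φ : MvPolynomial (Fin (n + 1)) k →ₐ[k] Polynomial k :=
    aeval (fun i => u (Fin.castSucc i)) with hφ
  have hle : (starSubIdeal k n I).map φ.toRingHom ≤ Ideal.span {T} :=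
    Ideal.map_le_iff_le_comap.2 (starSubIdeal_le_iff.2 fun l hl => by
      rw [Ideal.mem_comap]
      change φ (starCoord k n l) ∈ _
      rw [hφ, aeval_starCoord hu, huI l hl]
      exact Ideal.mem_span_singleton_self T)
  have hdvd : φ (∏ l, starCoord k n l ^ a l) ∈
      Ideal.span {T} ^ (∑ l, a l - ∑ l ∈ I, a l + 1) := by
    refine Ideal.pow_right_mono hle _ ?_
    rw [← Ideal.map_pow]
    exact Ideal.mem_map_of_mem φ.toRingHom hmem
  have hsum := sum_sdiff (f := a) (subset_univ I)
  have hexp : ∑ l, a l - ∑ l ∈ I, a l = ∑ l ∈ univ \ I, a l := by omega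
  have hprod : φ (∏ l, starCoord k n l ^ a l) =
      T ^ (∑ l ∈ univ \ I, a l) * ∏ l ∈ I, u l ^ a l := by
    simp only [map_prod, map_pow, hφ, aeval_starCoord hu]
    rw [← prod_sdiff (subset_univ I), ← prod_pow_eq_pow_sum]
    congr 1
    exact prod_congr rfl fun l hl => by rw [huI l (mem_sdiff.1 hl).2]
  rw [Ideal.span_singleton_pow, Ideal.mem_span_singleton, hprod, hexp, pow_succ,
    mul_dvd_mul_iff_left (pow_ne_zero _ Polynomial.X_ne_zero), Polynomial.X_dvd_iff,
    Polynomial.coeff_zero_eq_eval_zero, Polynomial.eval_prod, prod_eq_zero_iff] at hdvd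
  obtain ⟨l, hl, h⟩ := hdvd
  rw [Polynomial.eval_pow] at h
  exact hu0 l hl (eq_zero_of_pow_eq_zero h)

end Monomial

lemma exists_le_sum_eq {ι : Type*} [DecidableEq ι] (s : Finset ι) (b : ι → ℕ) {e : ℕ}
    (he : e ≤ ∑ i ∈ s, b i) : ∃ a : ι → ℕ, (∀ i, a i ≤ b i) ∧ ∑ i ∈ s, a i = e := by
  induction s using Finset.induction_on generalizing e with
  | empty => exact ⟨0, fun i => Nat.zero_le _, by simpa [eq_comm] using he⟩
  | insert x s hx ih =>
    rw [sum_insert hx] at he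
    obtain ⟨a, ha, hsum⟩ := ih (e := e - min e (b x)) (by omega)
    refine ⟨Function.update a x (min e (b x)), fun i => ?_, ?_⟩
    · by_cases hi : i = x
      · subst hi
        simp
      · simpa [hi] using ha i
    · rw [sum_insert hx, Function.update_self, sum_update_of_notMem hx, hsum]
      omega

lemma exists_le_sum_eq_of_subset {ι : Type*} [DecidableEq ι] [Fintype ι] (I : Finset ι)
    (b : ι → ℕ) {d : ℕ} (hd : d ≤ ∑ i, b i) :
    ∃ a : ι → ℕ, (∀ i, a i ≤ b i) ∧ ∑ i, a i = d ∧ ∑ i ∈ I, a i = min d (∑ i ∈ I, b i) := by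
  have hb := sum_sdiff (f := b) (subset_univ I)
  obtain ⟨a₁, h₁, hs₁⟩ := exists_le_sum_eq I b (min_le_right d _)
  obtain ⟨a₂, h₂, hs₂⟩ := exists_le_sum_eq (univ \ I) b
    (e := d - min d (∑ i ∈ I, b i)) (by omega)
  have hI : ∑ i ∈ I, (if i ∈ I then a₁ i else a₂ i) = min d (∑ i ∈ I, b i) := by
    rw [← hs₁]
    exact sum_congr rfl fun i hi => if_pos hi
  refine ⟨fun i => if i ∈ I then a₁ i else a₂ i, fun i => ?_, ?_, hI⟩
  · dsimp only
    split_ifs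
    exacts [h₁ i, h₂ i]
  · rw [← sum_sdiff (subset_univ I), hI,
      sum_congr rfl fun i hi => if_neg (mem_sdiff.1 hi).2, hs₂]
    omega

lemma mem_starSys_iff {k : Type} [Field k] {n d : ℕ} {m : Fin (n + 2) → ℕ}
    {F : MvPolynomial (Fin (n + 1)) k} :
    F ∈ starSys k n d m ↔ F.IsHomogeneous d ∧ ∀ i j, i < j →
      F ∈ pointIdeal k (n + 1) (starVec k n i - starVec k n j) ^ (m i + m j - d) := by
  simp [starSys, mem_homogeneousSubmodule]

/-- `λ_I` is contained in the base locus of the star system with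
multiplicity exactly `k_I = max(Σ_{i∈I} m_i − (|I|−1)d, 0)`. -/
theorem stmt11 (k : Type) [Field k] [IsAlgClosed k] [CharZero k]
    (n d : ℕ) (hn : 2 ≤ n) (m : Fin (n + 2) → ℕ)
    (hm : ∀ i, m i ≤ d) (hb : (∑ i, m i) ≤ (n + 1) * d)
    (I : Finset (Fin (n + 2))) (hc1 : 2 ≤ I.card) (hc2 : I.card ≤ n + 1) :
    (∀ F ∈ starSys k n d m, F ∈ starSubIdeal k n I ^
        ((∑ i ∈ I, (m i : ℤ)) - ((I.card : ℤ) - 1) * d).toNat) ∧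
    (starSys k n d m ≠ ⊥ → ∃ F ∈ starSys k n d m, F ∉ starSubIdeal k n I ^
        (((∑ i ∈ I, (m i : ℤ)) - ((I.card : ℤ) - 1) * d).toNat + 1)) := by
  have hbm : ∀ i, d - m i + m i = d := fun i => Nat.sub_add_cancel (hm i)
  have hpt : ∀ i j, m i + m j - d = d - ((d - m i) + (d - m j)) := by
    intro i j
    have := hm i
    have := hm j
    omega
  have hsum : ∀ J : Finset (Fin (n + 2)), ∑ i ∈ J, (d - m i) + ∑ i ∈ J, m i = J.card * d := by
    intro J
    rw [← sum_add_distrib, sum_congr rfl fun i _ => hbm i, sum_const, smul_eq_mul]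
  have hexp : ((∑ i ∈ I, (m i : ℤ)) - ((I.card : ℤ) - 1) * d).toNat =
      d - ∑ i ∈ I, (d - m i) := by
    have h := congrArg (Nat.cast (R := ℤ)) (hsum I)
    rw [Nat.cast_add, Nat.cast_mul, Nat.cast_sum (s := I) (f := m)] at h
    rw [sub_mul, one_mul]
    omega
  rw [hexp]
  refine ⟨fun F hF => ?_, fun _ => ?_⟩
  · obtain ⟨hd, hp⟩ := mem_starSys_iff.1 hF
    exact mem_starSubIdeal_pow hd (fun i j hij => hpt i j ▸ hp i j hij) I hc1
  · have hd : d ≤ ∑ i, (d - m i) := by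
      have := hsum univ
      rw [card_univ, Fintype.card_fin, show (n + 2) * d = (n + 1) * d + d by ring] at this
      omega
    obtain ⟨a, hab, had, haI⟩ := exists_le_sum_eq_of_subset I (fun i => d - m i) hd
    refine ⟨∏ l, starCoord k n l ^ a l, mem_starSys_iff.2 ⟨?_, fun i j hij => ?_⟩, ?_⟩
    · rw [← had]
      refine IsHomogeneous.prod _ _ _ fun l _ => ?_
      simpa using (isHomogeneous_starCoord l).pow (a l)
    · have hmem := prod_starCoord_mem_pow (I := {i, j})
        (K := pointIdeal k (n + 1) (starVec k n i - starVec k n j))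
        (fun l hl => by
          simp only [mem_insert, mem_singleton, not_or] at hl
          exact starCoord_mem_pointIdeal hl.1 hl.2) a
      rw [sum_pair hij.ne, had] at hmem
      refine Ideal.pow_le_pow_right ?_ hmem
      have hi : a i ≤ d - m i := hab i
      have hj : a j ≤ d - m j := hab j
      rw [hpt]
      omega
    · have hnot := prod_starCoord_notMem_pow (k := k) hc1 a
      rw [had, haI, tsub_min] at hnot
      exact hnot
end
end

section
/- Let k be an algebraically closed field of characteristic zero, let n ≥ 1, d ≥ 0, 1 ≤ s ≤ n+2, and let m_1,…,m_s ≥ 0 be integers. If gdim L_{n,d}(m_1,…,m_s) ≥ 1 (i.e. the linear system of degree-d hypersurfaces with multiplicities m_i at s points in general position is non-empty), then gdim L_{n,d}(m_1,…,m_s) = ℓ(n,d; m_1,…,m_s). (All non-empty linear systems with s ≤ n+2 general points are linearly non-special: h^0(D) = ldim(D).) -/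
open MvPolynomial Finset

noncomputable section

section DirectionalDerivative

variable {σ : Type} {k : Type} [Field k]

/-- The directional derivative `Σ v_i ∂/∂x_i`. -/
def dirDeriv (v : σ → k) : Derivation k (MvPolynomial σ k) (MvPolynomial σ k) :=
  mkDerivation k (fun i => C (v i))

@[simp]
lemma dirDeriv_X (v : σ → k) (i : σ) : dirDeriv v (X i) = C (v i) :=
  mkDerivation_X ..

lemma dirDeriv_add (v w : σ → k) : dirDeriv (v + w) = dirDeriv v + dirDeriv w :=
  derivation_ext fun i => by simp

lemma dirDeriv_smul (t : k) (v : σ → k) : dirDeriv (t • v) = t • dirDeriv v :=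
  derivation_ext fun i => by simp [smul_eq_C_mul]

lemma dirDeriv_single [DecidableEq σ] (i : σ) :
    dirDeriv (Pi.single i (1 : k)) = pderiv i :=
  derivation_ext fun j => by
    rw [dirDeriv_X, pderiv_X]
    by_cases h : i = j
    · subst h; simp
    · simp [Ne.symm h]

lemma dirDeriv_apply [Fintype σ] (v : σ → k) (F : MvPolynomial σ k) :
    dirDeriv v F = ∑ i, v i • pderiv i F := by
  classical
  have hsum (f : σ → Derivation k (MvPolynomial σ k) (MvPolynomial σ k))
      (G : MvPolynomial σ k) : (∑ i, f i) G = ∑ i, f i G := by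
    have := congr_fun (map_sum (Derivation.coeFnAddMonoidHom (R := k)
      (A := MvPolynomial σ k) (M := MvPolynomial σ k)) f Finset.univ) G
    rw [Finset.sum_apply] at this
    exact this
  have h : dirDeriv v = ∑ i, v i • (pderiv i : Derivation k (MvPolynomial σ k) _) := by
    refine derivation_ext fun j => ?_
    rw [dirDeriv_X, hsum, Finset.sum_eq_single j]
    · simp [smul_eq_C_mul]
    · intro b _ hb
      simp [pderiv_X_of_ne hb.symm]
    · simp
  rw [h, hsum]
  simp

lemma dirDeriv_isHomogeneous [Fintype σ] (v : σ → k) {F : MvPolynomial σ k} {d : ℕ}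
    (hF : F.IsHomogeneous d) : (dirDeriv v F).IsHomogeneous (d - 1) := by
  rw [dirDeriv_apply]
  refine IsHomogeneous.sum _ _ _ fun i _ => ?_
  exact (homogeneousSubmodule σ k (d - 1)).smul_mem _ hF.pderiv

/-- The iterated directional derivative, as a linear map. -/
abbrev dirPow (v : σ → k) (j : ℕ) : Module.End k (MvPolynomial σ k) :=
  ((dirDeriv v : Derivation k (MvPolynomial σ k) (MvPolynomial σ k)) :
    MvPolynomial σ k →ₗ[k] MvPolynomial σ k) ^ j

lemma dirPow_zero (v : σ → k) (F : MvPolynomial σ k) : dirPow v 0 F = F := by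
  simp [dirPow]

lemma dirPow_succ (v : σ → k) (j : ℕ) (F : MvPolynomial σ k) :
    dirPow v (j + 1) F = dirDeriv v (dirPow v j F) := by
  simp [dirPow, pow_succ']

lemma dirPow_add (v : σ → k) (i j : ℕ) (F : MvPolynomial σ k) :
    dirPow v (i + j) F = dirPow v i (dirPow v j F) := by
  simp [dirPow, pow_add]

lemma dirPow_isHomogeneous [Fintype σ] (v : σ → k) {F : MvPolynomial σ k} {d : ℕ}
    (hF : F.IsHomogeneous d) (j : ℕ) : (dirPow v j F).IsHomogeneous (d - j) := by
  induction j with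
  | zero => simpa [dirPow_zero] using hF
  | succ j ih =>
    rw [dirPow_succ, ← Nat.sub_sub]
    exact dirDeriv_isHomogeneous v ih

lemma dirPow_eq_zero [Fintype σ] (v : σ → k) {F : MvPolynomial σ k} {d : ℕ}
    (hF : F.IsHomogeneous d) {j : ℕ} (hj : d < j) : dirPow v j F = 0 := by
  obtain ⟨e, rfl⟩ := Nat.exists_eq_add_of_lt hj
  have h0 := dirPow_isHomogeneous v hF d
  rw [Nat.sub_self, ← totalDegree_zero_iff_isHomogeneous, totalDegree_eq_zero_iff_eq_C] at h0
  rw [show d + e + 1 = e + (1 + d) by ring, dirPow_add, add_comm 1 d, dirPow_succ, h0,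
    derivation_C, map_zero]

lemma dirPow_smul (t : k) (v : σ → k) (j : ℕ) (F : MvPolynomial σ k) :
    dirPow (t • v) j F = t ^ j • dirPow v j F := by
  have : ((dirDeriv (t • v) : Derivation k (MvPolynomial σ k) (MvPolynomial σ k)) :
    MvPolynomial σ k →ₗ[k] MvPolynomial σ k) = t • (dirDeriv v :
    MvPolynomial σ k →ₗ[k] MvPolynomial σ k) := by rw [dirDeriv_smul]; rfl
  rw [dirPow, this, smul_pow, LinearMap.smul_apply]

/-- The substitution `F ↦ F(Mx)`. -/
def linSubst [Fintype σ] (M : Matrix σ σ k) : MvPolynomial σ k →ₐ[k] MvPolynomial σ k :=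
  aeval (fun i => ∑ j, C (M i j) * X j)

lemma linSubst_X [Fintype σ] (M : Matrix σ σ k) (i : σ) :
    linSubst M (X i) = ∑ j, C (M i j) * X j := by
  simp [linSubst]

lemma linSubst_isHomogeneous [Fintype σ] (M : Matrix σ σ k) {F : MvPolynomial σ k} {d : ℕ}
    (hF : F.IsHomogeneous d) : (linSubst M F).IsHomogeneous d := by
  have := hF.aeval (n := 1) (fun i => ∑ j, C (M i j) * X j) fun i =>
    IsHomogeneous.sum _ _ _ fun j _ => (isHomogeneous_X k j).C_mul _
  simpa [linSubst] using this

lemma linSubst_mul [Fintype σ] (M N : Matrix σ σ k) (F : MvPolynomial σ k) :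
    linSubst N (linSubst M F) = linSubst (M * N) F := by
  have : (linSubst N).comp (linSubst M) = linSubst (M * N) := by
    refine MvPolynomial.algHom_ext fun i => ?_
    simp only [AlgHom.comp_apply, linSubst_X, map_sum, map_mul, Matrix.mul_apply, algHom_C,
      Finset.mul_sum, Finset.sum_mul]
    rw [Finset.sum_comm]
    simp [algebraMap_eq, mul_assoc]
  exact DFunLike.congr_fun this F

lemma linSubst_one [Fintype σ] [DecidableEq σ] (F : MvPolynomial σ k) :
    linSubst (1 : Matrix σ σ k) F = F := by
  have : linSubst (1 : Matrix σ σ k) = AlgHom.id k _ := by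
    refine MvPolynomial.algHom_ext fun i => ?_
    rw [linSubst_X, Finset.sum_eq_single i] <;> simp +contextual [eq_comm]
  rw [this]; rfl

lemma dirDeriv_linSubst [Fintype σ] (M : Matrix σ σ k) (v : σ → k) (F : MvPolynomial σ k) :
    dirDeriv v (linSubst M F) = linSubst M (dirDeriv (M.mulVec v) F) := by
  induction F using MvPolynomial.induction_on with
  | C a => simp [linSubst]
  | add p q hp hq => simp [hp, hq]
  | mul_X p i hp =>
    have hX : dirDeriv v (linSubst M (X i)) = linSubst M (dirDeriv (M.mulVec v) (X i)) := by
      rw [linSubst_X, dirDeriv_X, map_sum, algHom_C, algebraMap_eq]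
      simp [Matrix.mulVec, dotProduct]
    rw [map_mul, Derivation.leibniz, Derivation.leibniz, hp, hX]
    simp

lemma dirPow_linSubst [Fintype σ] (M : Matrix σ σ k) (v : σ → k) (j : ℕ)
    (F : MvPolynomial σ k) :
    dirPow v j (linSubst M F) = linSubst M (dirPow (M.mulVec v) j F) := by
  induction j with
  | zero => simp
  | succ j ih => rw [dirPow_succ, dirPow_succ, ih, dirDeriv_linSubst]

lemma linSubst_injective [Fintype σ] [DecidableEq σ] {M : Matrix σ σ k} (hM : M.det ≠ 0) :
    Function.Injective (linSubst M) := by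
  refine Function.LeftInverse.injective (g := linSubst M⁻¹) fun F => ?_
  rw [linSubst_mul, Matrix.mul_nonsing_inv _ (isUnit_iff_ne_zero.2 hM), linSubst_one]

end DirectionalDerivative

section Multiplicity

variable {k : Type} [Field k] {N : ℕ}

lemma pointIdeal_le_idealOfVars (v : Fin N → k) : pointIdeal k N v ≤ idealOfVars (Fin N) k := by
  refine Ideal.span_le.2 fun P hP => ?_
  have h1 : P ∈ idealOfVars (Fin N) k ^ 1 := by
    rw [mem_pow_idealOfVars_iff']
    intro x hx
    exact IsHomogeneous.coeff_eq_zero hP.1 (by omega)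
  simpa using h1

open scoped Pointwise in
lemma dirDeriv_mem_pointIdeal_pow (v : Fin N → k) (m : ℕ) {F : MvPolynomial (Fin N) k}
    (hF : F ∈ pointIdeal k N v ^ m) : dirDeriv v F ∈ pointIdeal k N v ^ m := by
  rw [pointIdeal, Ideal.span, Submodule.span_pow, ← Ideal.span] at *
  induction hF using Submodule.span_induction with
  | mem x hx =>
    have : dirDeriv v x = 0 := by
      clear F
      induction m generalizing x with
      | zero =>
        rw [pow_zero, Set.mem_one] at hx
        rw [hx, Derivation.map_one_eq_zero]
      | succ m ih =>
        rw [pow_succ] at hx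
        obtain ⟨a, ha, b, hb, rfl⟩ := Set.mem_mul.1 hx
        have hb' : dirDeriv v b = 0 := by
          have h2 := IsHomogeneous.sum_X_mul_pderiv hb.1
          have h3 : dirDeriv v b = C (eval v b) := by
            have h4 (i : Fin N) : pderiv i b = C (coeff 0 (pderiv i b)) := by
              have h5 : (pderiv i b).IsHomogeneous 0 := IsHomogeneous.pderiv hb.1
              rwa [← totalDegree_zero_iff_isHomogeneous, totalDegree_eq_zero_iff_eq_C] at h5
            rw [one_smul] at h2
            rw [dirDeriv_apply]
            conv_rhs => rw [← h2, map_sum, map_sum]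
            refine Finset.sum_congr rfl fun i _ => ?_
            rw [map_mul, h4 i]
            simp [smul_eq_C_mul]
          rw [h3, hb.2, C_0]
        rw [Derivation.leibniz, hb', ih a ha]
        simp
    rw [this]; exact zero_mem _
  | zero => simp
  | add x y _ _ hx hy => rw [map_add]; exact add_mem hx hy
  | smul a x hx h =>
    rw [smul_eq_mul, Derivation.leibniz]
    exact add_mem (Ideal.mul_mem_left _ _ h) (by
      rw [smul_eq_mul]; exact Ideal.mul_mem_right _ _ hx)

lemma dirPow_mem_pointIdeal_pow (v : Fin N → k) (m j : ℕ) {F : MvPolynomial (Fin N) k}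
    (hF : F ∈ pointIdeal k N v ^ m) : dirPow v j F ∈ pointIdeal k N v ^ m := by
  induction j with
  | zero => simpa
  | succ j ih => rw [dirPow_succ]; exact dirDeriv_mem_pointIdeal_pow v m ih

lemma eq_zero_of_isHomogeneous_of_mem_pow {v : Fin N → k} {m d : ℕ}
    {F : MvPolynomial (Fin N) k} (hF : F.IsHomogeneous d) (hm : F ∈ pointIdeal k N v ^ m)
    (hd : d < m) : F = 0 := by
  have h := (mem_pow_idealOfVars_iff' m F).1 (Ideal.pow_right_mono (pointIdeal_le_idealOfVars v) m hm)
  ext x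
  rw [coeff_zero]
  by_cases hx : x.degree = d
  · exact h x (by omega)
  · exact hF.coeff_eq_zero hx

lemma dirPow_eq_zero_of_mem_pow {v : Fin N → k} {m d : ℕ}
    {F : MvPolynomial (Fin N) k} (hF : F.IsHomogeneous d) (hm : F ∈ pointIdeal k N v ^ m) :
    dirPow v (d + 1 - m) F = 0 := by
  rcases Nat.eq_zero_or_pos m with rfl | hm0
  · exact dirPow_eq_zero v hF (by omega)
  · rcases lt_or_ge d m with h | h
    · rw [eq_zero_of_isHomogeneous_of_mem_pow hF hm h, map_zero]
    · exact eq_zero_of_isHomogeneous_of_mem_pow (dirPow_isHomogeneous v hF _)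
        (dirPow_mem_pointIdeal_pow v m _ hm) (by omega)

lemma coeff_dirPow_single [CharZero k] (i : Fin N) (j : ℕ) (F : MvPolynomial (Fin N) k)
    (x : Fin N →₀ ℕ) :
    ∃ c : k, c ≠ 0 ∧ coeff x (dirPow (Pi.single i (1 : k)) j F) =
      c * coeff (x + Finsupp.single i j) F := by
  induction j generalizing x with
  | zero => exact ⟨1, one_ne_zero, by simp⟩
  | succ j ih =>
    obtain ⟨c, hc, h⟩ := ih (x + Finsupp.single i 1)
    refine ⟨c * (x i + 1), mul_ne_zero hc (Nat.cast_add_one_ne_zero _), ?_⟩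
    rw [dirPow_succ, dirDeriv_single, coeff_pderiv, h, add_assoc, ← Finsupp.single_add,
      add_comm 1 j]
    ring

lemma dirPow_single_eq_zero_iff [CharZero k] (i : Fin N) (j : ℕ) (F : MvPolynomial (Fin N) k) :
    dirPow (Pi.single i (1 : k)) j F = 0 ↔ ∀ x ∈ F.support, x i < j := by
  constructor
  · intro h x hx
    by_contra! hlt
    obtain ⟨c, hc, h'⟩ := coeff_dirPow_single i j F (x - Finsupp.single i j)
    rw [h, coeff_zero, tsub_add_cancel_of_le (by simpa using hlt)] at h'
    exact (mem_support_iff.1 hx) ((mul_eq_zero.1 h'.symm).resolve_left hc)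
  · intro h
    ext x
    obtain ⟨c, hc, h'⟩ := coeff_dirPow_single i j F x
    rw [h', coeff_zero]
    by_contra hne
    have := h (x + Finsupp.single i j) (mem_support_iff.2 (right_ne_zero_of_mul hne))
    simp at this

lemma mem_pow_of_dirPow_single [CharZero k] (i : Fin N) {m d : ℕ}
    {F : MvPolynomial (Fin N) k} (hF : F.IsHomogeneous d)
    (h : dirPow (Pi.single i (1 : k)) (d + 1 - m) F = 0) :
    F ∈ pointIdeal k N (Pi.single i 1) ^ m := by
  rw [dirPow_single_eq_zero_iff] at h
  rw [F.as_sum]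
  refine Ideal.sum_mem _ fun x hx => ?_
  have hxd : x.degree = d := by
    by_contra hne
    exact mem_support_iff.1 hx (hF.coeff_eq_zero hne)
  have hX (j : Fin N) (hj : j ≠ i) : X j ∈ pointIdeal k N (Pi.single i 1) :=
    Ideal.subset_span ⟨isHomogeneous_X k j, by simp [hj]⟩
  have hle : m ≤ ∑ j ∈ Finset.univ.erase i, x j := by
    have h1 := Finset.add_sum_erase Finset.univ x (Finset.mem_univ i)
    rw [← Finsupp.degree_eq_sum, hxd] at h1
    have := h x hx
    omega
  rw [monomial_eq, Finsupp.prod_fintype _ _ (by simp),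
    ← Finset.mul_prod_erase Finset.univ _ (Finset.mem_univ i)]
  refine Ideal.mul_mem_left _ _ (Ideal.mul_mem_left _ _ (Ideal.pow_le_pow_right hle ?_))
  rw [← Finset.prod_pow_eq_pow_sum]
  exact Ideal.prod_mem_prod fun j hj => Ideal.pow_mem_pow (hX j (Finset.ne_of_mem_erase hj)) _

lemma linSubst_mem_pointIdeal_pow (M : Matrix (Fin N) (Fin N) k) (v : Fin N → k) (m : ℕ)
    {F : MvPolynomial (Fin N) k} (hF : F ∈ pointIdeal k N (M.mulVec v) ^ m) :
    linSubst M F ∈ pointIdeal k N v ^ m := by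
  have h1 : (pointIdeal k N (M.mulVec v)).map (linSubst M) ≤ pointIdeal k N v := by
    rw [pointIdeal, Ideal.map_span, Ideal.span_le]
    rintro _ ⟨P, hP, rfl⟩
    refine Ideal.subset_span ⟨linSubst_isHomogeneous M hP.1, ?_⟩
    have : (aeval v).comp (linSubst M) = aeval (M.mulVec v) :=
      MvPolynomial.algHom_ext fun i => by
        simp [linSubst_X, Matrix.mulVec, dotProduct]
    have h := DFunLike.congr_fun this P
    simpa [aeval_eq_eval, hP.2] using h
  have h2 := Ideal.mem_map_of_mem (linSubst M) hF
  rw [Ideal.map_pow] at h2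
  exact Ideal.pow_right_mono h1 m h2

lemma exists_det_ne_zero_mulVec_single {v : Fin N → k} (hv : v ≠ 0) :
    ∃ (M : Matrix (Fin N) (Fin N) k) (i : Fin N), M.det ≠ 0 ∧ M.mulVec (Pi.single i 1) = v := by
  obtain ⟨i, hi⟩ := Function.ne_iff.1 hv
  refine ⟨(1 : Matrix (Fin N) (Fin N) k).updateCol i v, i, ?_, ?_⟩
  · rw [← Matrix.cramer_apply, Matrix.cramer_one]
    simpa using hi
  · ext j
    simp

/-- A form of degree `d` has multiplicity at least `m` at `v` iff its `(d+1-m)`-th derivative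
along `v` vanishes. -/
lemma mem_pointIdeal_pow_iff [CharZero k] {v : Fin N → k} (hv : v ≠ 0) {m d : ℕ}
    {F : MvPolynomial (Fin N) k} (hF : F.IsHomogeneous d) :
    F ∈ pointIdeal k N v ^ m ↔ dirPow v (d + 1 - m) F = 0 := by
  refine ⟨dirPow_eq_zero_of_mem_pow hF, fun h => ?_⟩
  obtain ⟨M, i, hM, rfl⟩ := exists_det_ne_zero_mulVec_single hv
  have h1 : dirPow (Pi.single i (1 : k)) (d + 1 - m) (linSubst M F) = 0 := by
    rw [dirPow_linSubst, h, map_zero]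
  have hu := isUnit_iff_ne_zero.2 hM
  have h2 := mem_pow_of_dirPow_single i (linSubst_isHomogeneous M hF) h1
  have h3 := linSubst_mem_pointIdeal_pow M⁻¹ (M.mulVec (Pi.single i 1)) m (F := linSubst M F)
    (by rwa [Matrix.mulVec_mulVec, Matrix.nonsing_inv_mul _ hu, Matrix.one_mulVec])
  rwa [linSubst_mul, Matrix.mul_nonsing_inv _ hu, linSubst_one] at h3

end Multiplicity

section Lefschetz

variable {σ : Type} {k : Type} [Field k]

/-- Exponents of total degree `a` bounded by `c`. -/
def boxSet (c : σ → ℕ) (a : ℕ) : Set (σ →₀ ℕ) :=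
  {x | x.degree = a ∧ ∀ i, x i ≤ c i}

variable (k) in
/-- Forms of degree `a` whose degree in the `i`-th variable is at most `c i`. -/
def boxForms (c : σ → ℕ) (a : ℕ) : Submodule k (MvPolynomial σ k) :=
  restrictSupport k (boxSet c a)

lemma finrank_boxForms (c : σ → ℕ) (a : ℕ) :
    Module.finrank k (boxForms k c a) = Nat.card (boxSet c a) :=
  Module.finrank_eq_nat_card_basis (basisRestrictSupport k (boxSet c a))

lemma mem_boxForms {c : σ → ℕ} {a : ℕ} {F : MvPolynomial σ k} :
    F ∈ boxForms k c a ↔ F.IsHomogeneous a ∧ ∀ x ∈ F.support, ∀ i, x i ≤ c i := by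
  rw [boxForms, mem_restrictSupport_iff]
  constructor
  · refine fun h => ⟨fun x hx => ?_, fun x hx => (h (mem_coe.2 hx)).2⟩
    rw [← (h (mem_coe.2 (mem_support_iff.2 hx))).1, Finsupp.degree_eq_weight_one]
    rfl
  · refine fun h x hx => ⟨?_, h.2 x hx⟩
    by_contra hne
    exact mem_support_iff.1 (mem_coe.1 hx) (h.1.coeff_eq_zero hne)

lemma dirDeriv_pderiv_comm (v : σ → k) (i : σ) (F : MvPolynomial σ k) :
    dirDeriv v (pderiv i F) = pderiv i (dirDeriv v F) := by
  classical
  have h : ⁅dirDeriv v, (pderiv i : Derivation k (MvPolynomial σ k) _)⁆ = 0 :=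
    derivation_ext fun j => by
      rw [Derivation.commutator_apply, dirDeriv_X, pderiv_C, pderiv_X]
      by_cases h : i = j
      · subst h; simp
      · simp [Ne.symm h]
  have h' := congrArg (fun D => D F) h
  simp only [Derivation.commutator_apply, Derivation.coe_zero, Pi.zero_apply] at h'
  exact sub_eq_zero.1 h'

variable [Fintype σ]

lemma boxSet_finite (c : σ → ℕ) (a : ℕ) : (boxSet c a).Finite := by
  classical
  refine (Finset.finite_toSet (Finset.finsuppAntidiag Finset.univ a)).subset fun x hx => ?_
  simp [← hx.1, Finsupp.degree_eq_sum]

instance (c : σ → ℕ) (a : ℕ) : Finite (boxSet c a) := (boxSet_finite c a).to_subtype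

instance (c : σ → ℕ) (a : ℕ) : Module.Finite k (boxForms k c a) :=
  Module.Finite.of_basis (basisRestrictSupport k (boxSet c a))

lemma dirDeriv_mem_boxForms (v : σ → k) {c : σ → ℕ} {a : ℕ} {F : MvPolynomial σ k}
    (hF : F ∈ boxForms k c a) : dirDeriv v F ∈ boxForms k c (a - 1) := by
  classical
  rw [mem_boxForms] at *
  refine ⟨dirDeriv_isHomogeneous v hF.1, fun x hx i => ?_⟩
  rw [mem_support_iff, dirDeriv_apply, coeff_sum] at hx
  obtain ⟨l, -, hl⟩ := Finset.exists_ne_zero_of_sum_ne_zero hx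
  rw [coeff_smul, coeff_pderiv, smul_eq_mul] at hl
  have := hF.2 (x + Finsupp.single l 1)
    (mem_support_iff.2 (left_ne_zero_of_mul (right_ne_zero_of_mul hl))) i
  simp at this
  omega

lemma dirPow_mem_boxForms (v : σ → k) (j : ℕ) {c : σ → ℕ} {a : ℕ} {F : MvPolynomial σ k}
    (hF : F ∈ boxForms k c a) : dirPow v j F ∈ boxForms k c (a - j) := by
  induction j with
  | zero => simpa
  | succ j ih =>
    rw [dirPow_succ, ← Nat.sub_sub]
    exact dirDeriv_mem_boxForms v ih

variable (k) in
/-- The raising operator of the `sl₂`-action on polynomials of bounded multidegree, paired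
with the lowering operator `Σ ∂/∂x_i`. -/
def raiseOp (c : σ → ℕ) : MvPolynomial σ k →ₗ[k] MvPolynomial σ k :=
  ∑ i, ((c i : k) • LinearMap.mulLeft k (X i) -
    LinearMap.mulLeft k (X i ^ 2) ∘ₗ
      ((pderiv i : Derivation k (MvPolynomial σ k) (MvPolynomial σ k)) :
        MvPolynomial σ k →ₗ[k] MvPolynomial σ k))

lemma raiseOp_apply (c : σ → ℕ) (F : MvPolynomial σ k) :
    raiseOp k c F = ∑ i, ((c i : k) • (X i * F) - X i ^ 2 * pderiv i F) := by
  simp [raiseOp]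

lemma raiseOp_mem_boxForms {c : σ → ℕ} {a : ℕ} {F : MvPolynomial σ k}
    (hF : F ∈ boxForms k c a) : raiseOp k c F ∈ boxForms k c (a + 1) := by
  classical
  suffices h : boxForms k c a ≤ (boxForms k c (a + 1)).comap (raiseOp k c) from h hF
  conv_lhs => rw [boxForms, restrictSupport_eq_span]
  rw [Submodule.span_le]
  rintro _ ⟨x, hx, rfl⟩
  simp only [Submodule.comap_coe, Set.mem_preimage, SetLike.mem_coe, raiseOp_apply]
  refine Submodule.sum_mem _ fun i _ => ?_
  have h : (c i : k) • (X i * monomial x (1 : k)) - X i ^ 2 * pderiv i (monomial x (1 : k)) =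
      monomial (x + Finsupp.single i 1) ((c i : k) - x i) := by
    rw [pow_two, mul_assoc, X_mul_pderiv_monomial, mul_smul_comm, X,
      monomial_mul, ← Nat.cast_smul_eq_nsmul k, ← sub_smul, smul_monomial]
    simp [add_comm]
  rw [h]
  by_cases hi : x i = c i
  · simp [hi]
  · refine (monomial_mem_restrictSupport k).2 (Or.inl ⟨?_, fun l => ?_⟩)
    · rw [map_add, hx.1]; simp
    · have h1 := hx.2 l
      by_cases hl : i = l
      · subst hl; simp; omega
      · simpa [Finsupp.single_apply, hl] using h1

lemma dirDeriv_raiseOp (c : σ → ℕ) {a : ℕ} {F : MvPolynomial σ k} (hF : F.IsHomogeneous a) :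
    dirDeriv 1 (raiseOp k c F) =
      raiseOp k c (dirDeriv 1 F) + ((∑ i, c i : ℕ) - 2 * a : k) • F := by
  have h : ∀ i, dirDeriv (1 : σ → k) ((c i : k) • (X i * F) - X i ^ 2 * pderiv i F) =
      ((c i : k) • (X i * dirDeriv 1 F) - X i ^ 2 * pderiv i (dirDeriv 1 F)) +
        ((c i : k) • F - (2 : k) • (X i * pderiv i F)) := fun i => by
    rw [map_sub, Derivation.map_smul, Derivation.leibniz, Derivation.leibniz,
      Derivation.leibniz_pow, dirDeriv_pderiv_comm]
    simp only [dirDeriv_X, Pi.one_apply, C_1, smul_eq_mul, smul_eq_C_mul, nsmul_eq_mul, map_ofNat]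
    push_cast
    ring
  have h2 := hF.sum_X_mul_pderiv
  rw [raiseOp_apply, map_sum, Finset.sum_congr rfl fun i _ => h i, Finset.sum_add_distrib,
    ← raiseOp_apply, Finset.sum_sub_distrib, ← Finset.smul_sum, h2, ← Finset.sum_smul,
    sub_smul, mul_smul, Nat.cast_smul_eq_nsmul k a, Nat.cast_sum]

lemma dirPow_raiseOp (c : σ → ℕ) {a : ℕ} {F : MvPolynomial σ k} (hF : F.IsHomogeneous a)
    (j : ℕ) : dirPow 1 (j + 1) (raiseOp k c F) =
      raiseOp k c (dirPow 1 (j + 1) F) +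
        ((j + 1) * ((∑ i, c i : ℕ) - 2 * a + j) : k) • dirPow 1 j F := by
  induction j with
  | zero =>
    rw [dirPow_succ, dirPow_succ, dirPow_zero, dirPow_zero, dirDeriv_raiseOp c hF]
    simp
  | succ j ih =>
    rw [dirPow_succ, ih, map_add, dirDeriv_raiseOp c (dirPow_isHomogeneous 1 hF (j + 1)),
      Derivation.map_smul, ← dirPow_succ, ← dirPow_succ, add_assoc, ← add_smul]
    rcases le_or_gt (j + 1) a with h | h
    · congr 2
      rw [Nat.cast_sub h]
      push_cast
      ring
    · rw [dirPow_eq_zero 1 hF h]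
      simp

/-- Injectivity part of the strong Lefschetz property for monomial complete intersections. -/
lemma eq_zero_of_dirPow_eq_zero [CharZero k] (c : σ → ℕ) {a : ℕ} (ha : ∑ i, c i ≤ 2 * a)
    {F : MvPolynomial σ k} (hF : F ∈ boxForms k c a)
    (h : dirPow 1 (2 * a - ∑ i, c i) F = 0) : F = 0 := by
  rcases lt_or_ge (∑ i, c i) a with hlt | hle
  · rw [mem_boxForms] at hF
    by_contra hne
    obtain ⟨x, hx⟩ := support_nonempty.2 hne
    have h1 : x.degree = a := by
      by_contra hn
      exact mem_support_iff.1 hx (hF.1.coeff_eq_zero hn)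
    have h2 := Finset.sum_le_sum fun i (_ : i ∈ Finset.univ) => hF.2 x hx i
    rw [← Finsupp.degree_eq_sum] at h2
    omega
  · have hU : raiseOp k c F = 0 := by
      refine eq_zero_of_dirPow_eq_zero c (a := a + 1) (by omega) (raiseOp_mem_boxForms hF) ?_
      rw [show 2 * (a + 1) - ∑ i, c i = 1 + (2 * a - ∑ i, c i) + 1 by omega,
        dirPow_raiseOp c (mem_boxForms.1 hF).1, dirPow_succ, dirPow_add, h]
      simp
    have key : ∀ j ≤ 2 * a - ∑ i, c i, dirPow 1 j F = 0 → F = 0 := by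
      intro j
      induction j with
      | zero => intro _ h; simpa using h
      | succ j ih =>
        intro hj h
        have h1 := dirPow_raiseOp c (mem_boxForms.1 hF).1 j
        rw [hU, h, map_zero, map_zero, zero_add, eq_comm, smul_eq_zero] at h1
        refine ih (by omega) (h1.resolve_left (mul_ne_zero (Nat.cast_add_one_ne_zero j) ?_))
        intro h0
        have h2 : ((∑ i, c i + j : ℕ) : k) = ((2 * a : ℕ) : k) := by
          push_cast at h0 ⊢
          linear_combination h0
        have := Nat.cast_injective h2
        omega
    exact key _ le_rfl h
termination_by (∑ i, c i) + 1 - a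

lemma card_boxSet_symm (c : σ → ℕ) {a b : ℕ} (h : a + b = ∑ i, c i) :
    Nat.card (boxSet c a) = Nat.card (boxSet c b) := by
  have key : ∀ {a b : ℕ}, a + b = ∑ i, c i → ∀ x ∈ boxSet c a,
      (Finsupp.equivFunOnFinite.symm c - x) ∈ boxSet c b := by
    intro a b h x hx
    refine ⟨?_, fun i => by simp⟩
    have h1 : (Finsupp.equivFunOnFinite.symm c - x).degree + x.degree = ∑ i, c i := by
      rw [← map_add, tsub_add_cancel_of_le (fun i => by simpa using hx.2 i),
        Finsupp.degree_eq_sum]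
      rfl
    rw [hx.1] at h1
    omega
  have inv : ∀ {a : ℕ}, ∀ x ∈ boxSet c a,
      Finsupp.equivFunOnFinite.symm c - (Finsupp.equivFunOnFinite.symm c - x) = x := by
    intro a x hx
    exact tsub_tsub_cancel_of_le fun i => by simpa using hx.2 i
  exact Nat.card_congr ⟨fun x => ⟨_, key h x x.2⟩, fun x => ⟨_, key (by omega) x x.2⟩,
    fun x => Subtype.ext (inv x x.2), fun x => Subtype.ext (inv x x.2)⟩

/-- The iterated derivative as a map between forms of bounded multidegree. -/
def boxDeriv (v : σ → k) (c : σ → ℕ) (a j : ℕ) : boxForms k c a →ₗ[k] boxForms k c (a - j) :=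
  (dirPow v j).restrict fun _ => dirPow_mem_boxForms v j

/-- The strong Lefschetz property for monomial complete intersections. -/
lemma boxDeriv_injective_or_surjective [CharZero k] (c : σ → ℕ) {d j : ℕ} (hj : j ≤ d) :
    Function.Injective (boxDeriv (1 : σ → k) c d j) ∨
      Function.Surjective (boxDeriv (1 : σ → k) c d j) := by
  rcases le_or_gt (∑ i, c i) (2 * d - j) with h | h
  · left
    rw [injective_iff_map_eq_zero]
    intro F hF
    refine Subtype.ext (eq_zero_of_dirPow_eq_zero c (a := d) (by omega) F.2 ?_)
    have h1 : dirPow (1 : σ → k) j F = 0 := congrArg Subtype.val hF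
    rw [show 2 * d - ∑ i, c i = (2 * d - ∑ i, c i - j) + j by omega, dirPow_add, h1, map_zero]
  · right
    set a := ∑ i, c i - (d - j) with ha
    have hinj : Function.Injective (boxDeriv (1 : σ → k) c a (2 * a - ∑ i, c i)) := by
      rw [injective_iff_map_eq_zero]
      intro F hF
      exact Subtype.ext (eq_zero_of_dirPow_eq_zero c (a := a) (by omega) F.2
        (congrArg Subtype.val hF))
    have hsurj := (LinearMap.injective_iff_surjective_of_finrank_eq_finrank (by
      rw [finrank_boxForms, finrank_boxForms]
      exact card_boxSet_symm c (by omega))).1 hinj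
    have he : a - (2 * a - ∑ i, c i) = d - j := by omega
    intro G
    obtain ⟨F, hF⟩ := hsurj ⟨G.1, by rw [he]; exact G.2⟩
    have h1 := dirPow_mem_boxForms (1 : σ → k) (a - d) F.2
    refine ⟨⟨_, by rwa [show a - (a - d) = d by omega] at h1⟩, Subtype.ext ?_⟩
    have h2 : dirPow (1 : σ → k) (2 * a - ∑ i, c i) F = G := congrArg Subtype.val hF
    change dirPow (1 : σ → k) j (dirPow (1 : σ → k) (a - d) F) = G
    rw [← h2, ← dirPow_add]
    congr 2
    omega

lemma finrank_boxForms_inf_ker [CharZero k] (c : σ → ℕ) {d j : ℕ} (hj : j ≤ d)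
    (hne : boxForms k c d ⊓ LinearMap.ker (dirPow 1 j) ≠ ⊥) :
    Module.finrank k ↥(boxForms k c d ⊓ LinearMap.ker (dirPow 1 j)) +
      Nat.card (boxSet c (d - j)) = Nat.card (boxSet c d) := by
  have hK : (LinearMap.ker (boxDeriv (1 : σ → k) c d j)).map (boxForms k c d).subtype =
      boxForms k c d ⊓ LinearMap.ker (dirPow 1 j) := by
    ext F
    constructor
    · rintro ⟨G, hG, rfl⟩
      exact ⟨G.2, congrArg Subtype.val (LinearMap.mem_ker.1 hG)⟩
    · rintro ⟨h1, h2⟩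
      exact ⟨⟨F, h1⟩, LinearMap.mem_ker.2 (Subtype.ext (LinearMap.mem_ker.1 h2)), rfl⟩
  have hsurj : Function.Surjective (boxDeriv (1 : σ → k) c d j) := by
    refine (boxDeriv_injective_or_surjective c hj).resolve_left fun hinj => hne ?_
    rw [← hK, LinearMap.ker_eq_bot.2 hinj, Submodule.map_bot]
  have h1 := LinearMap.finrank_range_add_finrank_ker (boxDeriv (1 : σ → k) c d j)
  rw [LinearMap.range_eq_top.2 hsurj, finrank_top, finrank_boxForms, finrank_boxForms] at h1
  rw [← hK, Submodule.finrank_map_subtype_eq]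
  omega

end Lefschetz

section Counting

/-- Exponents of total degree `z` in `n + 1` variables, bounded by `c` at the indices in `S`. -/
def boundedExps (n : ℕ) (c : ℕ → ℕ) (S : Finset ℕ) (z : ℤ) : Set (Fin (n + 1) →₀ ℕ) :=
  {x | (x.degree : ℤ) = z ∧ ∀ i : Fin (n + 1), (i : ℕ) ∈ S → x i ≤ c i}

/-- The number of monomials of degree `z` in `n + 1` variables. -/
def monomialCount (n : ℕ) (z : ℤ) : ℤ :=
  if z < 0 then 0 else ((n + z.toNat).choose n : ℤ)

lemma boundedExps_empty (n : ℕ) (c : ℕ → ℕ) (a : ℕ) :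
    boundedExps n c ∅ a =
      (Finset.finsuppAntidiag (Finset.univ : Finset (Fin (n + 1))) a : Set _) := by
  ext x
  simp only [boundedExps, Finsupp.degree_eq_sum, Nat.cast_inj]
  simp

lemma boundedExps_of_neg (n : ℕ) (c : ℕ → ℕ) (S : Finset ℕ) {z : ℤ} (hz : z < 0) :
    boundedExps n c S z = ∅ := by
  ext x
  simp only [boundedExps, Set.mem_ofPred_eq, Set.mem_empty_iff_false, iff_false, not_and]
  intro h
  omega

lemma boundedExps_finite (n : ℕ) (c : ℕ → ℕ) (S : Finset ℕ) (z : ℤ) :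
    (boundedExps n c S z).Finite := by
  rcases lt_or_ge z 0 with hz | hz
  · simp [boundedExps_of_neg n c S hz]
  · lift z to ℕ using hz
    refine Set.Finite.subset ?_ (t := boundedExps n c S z) (s := boundedExps n c ∅ z)
      fun x hx => ⟨hx.1, by simp⟩
    rw [boundedExps_empty]
    exact Finset.finite_toSet _

lemma ncard_boundedExps_empty (n : ℕ) (c : ℕ → ℕ) (z : ℤ) :
    ((boundedExps n c ∅ z).ncard : ℤ) = monomialCount n z := by
  rcases lt_or_ge z 0 with hz | hz
  · simp [boundedExps_of_neg n c _ hz, monomialCount, hz]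
  · lift z to ℕ using hz
    rw [boundedExps_empty, Set.ncard_coe_finset, Finset.card_finsuppAntidiag_nat_eq_choose]
    have : n + 1 + z - 1 = n + z := by omega
    rw [monomialCount, if_neg (by omega), Finset.card_univ, Fintype.card_fin, this,
      Int.toNat_natCast, Nat.choose_symm_add]

lemma ncard_boundedExps_insert {n : ℕ} (c : ℕ → ℕ) {S : Finset ℕ} {j : ℕ} (hj : j ∉ S)
    (hjn : j < n + 1) (z : ℤ) :
    (boundedExps n c (insert j S) z).ncard + (boundedExps n c S (z - (c j + 1))).ncard =
      (boundedExps n c S z).ncard := by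
  set e : Fin (n + 1) →₀ ℕ := Finsupp.single ⟨j, hjn⟩ (c j + 1) with he
  have hne (i : Fin (n + 1)) (hi : (i : ℕ) ∈ S) : e i = 0 := by
    rw [he, Finsupp.single_apply, if_neg]
    rintro rfl
    exact hj hi
  have hunion : boundedExps n c S z =
      boundedExps n c (insert j S) z ∪
        Set.image (· + e) (boundedExps n c S (z - (c j + 1))) := by
    ext x
    constructor
    · rintro ⟨h1, h2⟩
      by_cases hx : x ⟨j, hjn⟩ ≤ c j
      · refine Or.inl ⟨h1, fun i hi => ?_⟩
        rcases Finset.mem_insert.1 hi with h | h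
        · have : i = ⟨j, hjn⟩ := Fin.ext h
          rw [this]; exact hx
        · exact h2 i h
      · have hle : e ≤ x := by
          rw [he, Finsupp.single_le_iff]; omega
        refine Or.inr ⟨x - e, ⟨?_, fun i hi => ?_⟩, tsub_add_cancel_of_le hle⟩
        · have h3 : (x - e).degree + e.degree = x.degree := by
            rw [← map_add, tsub_add_cancel_of_le hle]
          have h4 : e.degree = c j + 1 := by rw [he, Finsupp.degree_single]
          omega
        · exact (Nat.sub_le _ _).trans (h2 i hi)
    · rintro (⟨h1, h2⟩ | ⟨y, ⟨h1, h2⟩, rfl⟩)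
      · exact ⟨h1, fun i hi => h2 i (Finset.mem_insert_of_mem hi)⟩
      · refine ⟨?_, fun i hi => ?_⟩
        · simp only [map_add, he, Finsupp.degree_single]
          push_cast
          omega
        · simpa [hne i hi] using h2 i hi
  have hdisj : Disjoint (boundedExps n c (insert j S) z)
      (Set.image (· + e) (boundedExps n c S (z - (c j + 1)))) := by
    rw [Set.disjoint_right]
    rintro _ ⟨y, -, rfl⟩ ⟨-, h⟩
    have := h ⟨j, hjn⟩ (Finset.mem_insert_self _ _)
    simp [he] at this
    omega
  rw [hunion, Set.ncard_union_eq hdisj (boundedExps_finite ..)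
    ((boundedExps_finite ..).image _), Set.ncard_image_of_injective _ (add_left_injective e)]

lemma ncard_boundedExps {n : ℕ} (c : ℕ → ℕ) (S : Finset ℕ) (hS : S ⊆ Finset.range (n + 1))
    (z : ℤ) : ((boundedExps n c S z).ncard : ℤ) =
      ∑ I ∈ S.powerset, (-1) ^ I.card * monomialCount n (z - ∑ i ∈ I, ((c i : ℤ) + 1)) := by
  induction S using Finset.induction_on generalizing z with
  | empty => simp [ncard_boundedExps_empty]
  | insert j S hj ih =>
    have hS' := (Finset.subset_insert j S).trans hS
    have h := ncard_boundedExps_insert c hj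
      (Finset.mem_range.1 (hS (Finset.mem_insert_self j S))) z
    rw [Finset.sum_powerset_insert hj, ← ih hS', ← h]
    push_cast
    rw [ih hS', add_assoc, left_eq_add, ← Finset.sum_add_distrib]
    refine Finset.sum_eq_zero fun I hI => ?_
    have hjI : j ∉ I := fun h => hj (Finset.mem_powerset.1 hI h)
    rw [Finset.card_insert_of_notMem hjI, Finset.sum_insert hjI, pow_succ, sub_sub]
    ring

lemma binomZ_kIdx {n d : ℕ} {m : ℕ → ℕ} (I : Finset ℕ) (hm : ∀ i ∈ I, m i ≤ d) :
    binomZ ((n : ℤ) + kIdx d m I - (I.card : ℤ)) n =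
      monomialCount n (d - ∑ i ∈ I, (((d - m i : ℕ) : ℤ) + 1)) := by
  have hsum : (d : ℤ) - ∑ i ∈ I, (((d - m i : ℕ) : ℤ) + 1) =
      (∑ i ∈ I, (m i : ℤ)) - ((I.card : ℤ) - 1) * d - I.card := by
    rw [Finset.sum_congr rfl fun i hi => by rw [Nat.cast_sub (hm i hi)],
      Finset.sum_add_distrib, Finset.sum_sub_distrib]
    simp
    ring
  rw [hsum, kIdx, binomZ, monomialCount]
  set r := (∑ i ∈ I, (m i : ℤ)) - ((I.card : ℤ) - 1) * d with hr
  have h0 : I.card = 0 → 0 ≤ r := by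
    intro h
    rw [Finset.card_eq_zero] at h
    subst h
    simp [hr]
  by_cases h : r - I.card < 0
  · rw [if_pos h, if_pos (by omega)]
  · rw [if_neg h, if_neg (by omega)]
    congr 2
    omega

lemma ldim_eq {n d : ℕ} {m : ℕ → ℕ} (hm : ∀ i < n + 2, m i ≤ d) :
    ldim n d (n + 2) m =
      (boundedExps n (fun i => d - m i) (Finset.range (n + 1)) d).ncard -
      (boundedExps n (fun i => d - m i) (Finset.range (n + 1)) (m (n + 1) - 1)).ncard := by
  have hmem {I : Finset ℕ} (hI : I ∈ (Finset.range (n + 2)).powerset) : ∀ i ∈ I, m i ≤ d :=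
    fun i hi => hm i (Finset.mem_range.1 (Finset.mem_powerset.1 hI hi))
  rw [ldim, Finset.sum_congr rfl fun I hI => by rw [binomZ_kIdx I (hmem hI)],
    Finset.range_add_one, Finset.sum_powerset_insert Finset.notMem_range_self,
    ncard_boundedExps _ _ subset_rfl, ncard_boundedExps _ _ subset_rfl, sub_eq_add_neg,
    ← Finset.sum_neg_distrib]
  congr 1
  refine Finset.sum_congr rfl fun I hI => ?_
  have hjI : n + 1 ∉ I := fun h => Finset.notMem_range_self (Finset.mem_powerset.1 hI h)
  rw [Finset.card_insert_of_notMem hjI, Finset.sum_insert hjI, pow_succ,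
    Nat.cast_sub (hm (n + 1) (by omega)), ← sub_sub,
    show (d : ℤ) - (d - m (n + 1) + 1) = m (n + 1) - 1 by ring]
  ring

lemma ldim_eq_of_le {n d s : ℕ} {m m' : ℕ → ℕ} (hs : s ≤ n + 2) (hm : ∀ i < s, m' i = m i)
    (hm0 : ∀ i, s ≤ i → m' i = 0) (hd : ∀ i, m' i ≤ d) :
    ldim n d s m = ldim n d (n + 2) m' := by
  have h1 : ldim n d s m = ldim n d s m' := by
    refine Finset.sum_congr rfl fun I hI => ?_
    rw [kIdx, kIdx, Finset.sum_congr rfl fun i hi => by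
      rw [← hm i (Finset.mem_range.1 (Finset.mem_powerset.1 hI hi))]]
  rw [h1, ldim, ldim]
  refine Finset.sum_subset (Finset.powerset_mono.2 (Finset.range_mono hs)) fun I _ hI => ?_
  obtain ⟨j, hj, hjs⟩ := Finset.not_subset.1 (mt Finset.mem_powerset.2 hI)
  rw [binomZ_kIdx I fun i _ => hd i, monomialCount, if_pos, mul_zero]
  rw [← Finset.add_sum_erase I _ hj, hm0 j (by simpa using hjs)]
  have : 0 ≤ ∑ i ∈ I.erase j, (((d - m' i : ℕ) : ℤ) + 1) :=
    Finset.sum_nonneg fun i _ => by positivity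
  simp
  omega

end Counting

section Semicontinuity

variable {k : Type} [Field k]

/-- The kernel dimension of a polynomial one-parameter family of linear maps is generically at
most its value at the origin. -/
lemma exists_finrank_ker_le {V W : Type} [AddCommGroup V] [Module k V] [Module.Finite k V]
    [AddCommGroup W] [Module k W] (T : k → V →ₗ[k] W)
    (hT : ∀ (v : V) (ψ : W →ₗ[k] k), ∃ P : Polynomial k, ∀ t, ψ (T t v) = P.eval t) :
    ∃ Q : Polynomial k, Q ≠ 0 ∧ ∀ t, Q.eval t ≠ 0 →
      Module.finrank k (LinearMap.ker (T t)) ≤ Module.finrank k (LinearMap.ker (T 0)) := by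
  obtain ⟨U, hU⟩ := Submodule.exists_isCompl (LinearMap.ker (T 0))
  have hker : LinearMap.ker (T 0 ∘ₗ U.subtype) = ⊥ := by
    rw [LinearMap.ker_eq_bot']
    intro x hx
    exact Subtype.ext (Submodule.disjoint_def.1 hU.disjoint x (LinearMap.mem_ker.2 hx) x.2)
  obtain ⟨g, hg⟩ := LinearMap.exists_leftInverse_of_injective _ hker
  let b := Module.finBasis k U
  choose P hP using fun i j => hT (b j) (b.coord i ∘ₗ g)
  have hdet (t : k) : (Matrix.of P).det.eval t = LinearMap.det (g ∘ₗ T t ∘ₗ U.subtype) := by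
    rw [← LinearMap.det_toMatrix b, ← Polynomial.coe_evalRingHom, RingHom.map_det]
    congr 1
    ext i j
    simp [LinearMap.toMatrix_apply, ← hP]
  refine ⟨(Matrix.of P).det, fun h0 => ?_, fun t ht => ?_⟩
  · have h := hdet 0
    rw [hg, h0] at h
    simp at h
  · rw [hdet] at ht
    have hinj : LinearMap.ker (g ∘ₗ T t ∘ₗ U.subtype) = ⊥ := by
      by_contra h
      exact ht (LinearMap.det_eq_zero_iff_ker_ne_bot.2 h)
    have hd : Disjoint (LinearMap.ker (T t)) U := by
      rw [Submodule.disjoint_def]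
      intro x hx hxU
      have : (⟨x, hxU⟩ : U) ∈ LinearMap.ker (g ∘ₗ T t ∘ₗ U.subtype) := by
        rw [LinearMap.mem_ker] at hx
        simp [hx]
      rw [hinj, Submodule.mem_bot] at this
      exact congrArg Subtype.val this
    have h1 := Submodule.finrank_add_finrank_le_of_disjoint hd
    have h2 := Submodule.finrank_add_eq_of_isCompl hU
    omega

lemma exists_eval_eq_dirPow {σ : Type} (v w : σ → k) (j : ℕ) (F : MvPolynomial σ k)
    (ψ : MvPolynomial σ k →ₗ[k] k) :
    ∃ P : Polynomial k, ∀ t, ψ (dirPow (v + t • w) j F) = P.eval t := by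
  induction j generalizing ψ with
  | zero => exact ⟨Polynomial.C (ψ F), fun t => by simp⟩
  | succ j ih =>
    obtain ⟨P₁, h₁⟩ := ih (ψ ∘ₗ (dirDeriv v : MvPolynomial σ k →ₗ[k] MvPolynomial σ k))
    obtain ⟨P₂, h₂⟩ := ih (ψ ∘ₗ (dirDeriv w : MvPolynomial σ k →ₗ[k] MvPolynomial σ k))
    refine ⟨P₁ + Polynomial.X * P₂, fun t => ?_⟩
    rw [Polynomial.eval_add, Polynomial.eval_mul, Polynomial.eval_X, ← h₁, ← h₂, dirPow_succ,
      dirDeriv_add, dirDeriv_smul]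
    simp

lemma exists_eval_eq_det {ι : Type} [Fintype ι] [DecidableEq ι] (A B : Matrix ι ι k)
    (hB : B.det ≠ 0) : ∃ P : Polynomial k, P ≠ 0 ∧ ∀ t, P.eval t = (A + t • B).det := by
  refine ⟨((Polynomial.X : Polynomial k) • B.map Polynomial.C + A.map Polynomial.C).det,
    fun h => hB ?_, fun t => ?_⟩
  · rw [← Polynomial.coeff_det_X_add_C_card B A, h, Polynomial.coeff_zero]
  · rw [← Polynomial.coe_evalRingHom, RingHom.map_det]
    congr 1
    ext i j
    simp only [Polynomial.coe_evalRingHom, RingHom.mapMatrix_apply, Matrix.map_apply,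
      Matrix.add_apply, Matrix.smul_apply, smul_eq_mul, Polynomial.eval_add, Polynomial.eval_mul,
      Polynomial.eval_X, Polynomial.eval_C]
    ring

end Semicontinuity

section GenericPoints

variable {k : Type} [Field k]

lemma mem_linSys_iff [CharZero k] {n d s : ℕ} {m : ℕ → ℕ} {p : ℕ → (Fin (n + 1) → k)}
    (hp : ∀ i < s, p i ≠ 0) {F : MvPolynomial (Fin (n + 1)) k} :
    F ∈ linSys k n d s m p ↔
      F.IsHomogeneous d ∧ ∀ i < s, dirPow (p i) (d + 1 - m i) F = 0 := by
  rw [linSys, Submodule.mem_inf, mem_homogeneousSubmodule]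
  refine and_congr_right fun hF => ?_
  simp only [Submodule.mem_iInf, Finset.mem_range, Submodule.restrictScalars_mem]
  exact forall₂_congr fun i hi => mem_pointIdeal_pow_iff (hp i hi) hF

instance (n d : ℕ) : Module.Finite k (homogeneousSubmodule (Fin n) k d) :=
  Module.Finite.iff_fg.2 (weightedHomogeneousSubmodule_fg k 1 (by simp) d)

instance (n d s : ℕ) (m : ℕ → ℕ) (p : ℕ → (Fin (n + 1) → k)) :
    Module.Finite k (linSys k n d s m p) :=
  Submodule.finiteDimensional_of_le (inf_le_left : _ ≤ homogeneousSubmodule (Fin (n + 1)) k d)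

/-- The conditions imposed by points, as a linear map on forms. -/
def condMap (n d s : ℕ) (m : ℕ → ℕ) (p : ℕ → (Fin (n + 1) → k)) :
    homogeneousSubmodule (Fin (n + 1)) k d →ₗ[k] (Fin s → MvPolynomial (Fin (n + 1)) k) :=
  LinearMap.pi fun i => dirPow (p i) (d + 1 - m i) ∘ₗ Submodule.subtype _

lemma finrank_linSys [CharZero k] {n d s : ℕ} {m : ℕ → ℕ} {p : ℕ → (Fin (n + 1) → k)}
    (hp : ∀ i < s, p i ≠ 0) : Module.finrank k (linSys k n d s m p) =
      Module.finrank k (LinearMap.ker (condMap n d s m p)) := by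
  have h : linSys k n d s m p =
      (LinearMap.ker (condMap n d s m p)).map (Submodule.subtype _) := by
    ext F
    rw [mem_linSys_iff hp]
    constructor
    · rintro ⟨h1, h2⟩
      exact ⟨⟨F, h1⟩, LinearMap.mem_ker.2 (funext fun i => h2 i i.2), rfl⟩
    · rintro ⟨G, hG, rfl⟩
      exact ⟨G.2, fun i hi => congr_fun (LinearMap.mem_ker.1 hG) ⟨i, hi⟩⟩
  rw [h, Submodule.finrank_map_subtype_eq]

lemma exists_finrank_linSys_le [CharZero k] {n d s : ℕ} {m : ℕ → ℕ}
    {p : ℕ → (Fin (n + 1) → k)} (hp : ∀ i < s, p i ≠ 0) (q : ℕ → (Fin (n + 1) → k)) :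
    ∃ Q : Polynomial k, Q ≠ 0 ∧ ∀ t, Q.eval t ≠ 0 → (∀ i < s, p i + t • q i ≠ 0) →
      Module.finrank k (linSys k n d s m (p + t • q)) ≤
        Module.finrank k (linSys k n d s m p) := by
  obtain ⟨Q, hQ, h⟩ := exists_finrank_ker_le (fun t => condMap n d s m (p + t • q)) (by
    intro F ψ
    choose P hP using fun i : Fin s => exists_eval_eq_dirPow (p i) (q i) (d + 1 - m i) F.1
      (ψ ∘ₗ LinearMap.single k (fun _ => MvPolynomial (Fin (n + 1)) k) i)
    refine ⟨∑ i, P i, fun t => ?_⟩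
    have h (x : Fin s → MvPolynomial (Fin (n + 1)) k) : ψ x = ∑ i, ψ (Pi.single i (x i)) := by
      rw [← map_sum, Finset.univ_sum_single]
    rw [Polynomial.eval_finsetSum, h]
    exact Finset.sum_congr rfl fun i _ => hP i t)
  refine ⟨Q, hQ, fun t ht hne => ?_⟩
  rw [finrank_linSys (p := p + t • q) hne, finrank_linSys hp]
  have h' := h t ht
  rwa [zero_smul, add_zero] at h'

lemma finrank_linSys_le_of_mulVec [CharZero k] {n d s : ℕ} {m : ℕ → ℕ}
    {p q : ℕ → (Fin (n + 1) → k)} (hp : ∀ i < s, p i ≠ 0) (hq : ∀ i < s, q i ≠ 0)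
    {M : Matrix (Fin (n + 1)) (Fin (n + 1)) k} (hM : M.det ≠ 0) {μ : ℕ → k}
    (h : ∀ i < s, M.mulVec (q i) = μ i • p i) :
    Module.finrank k (linSys k n d s m p) ≤ Module.finrank k (linSys k n d s m q) := by
  rw [(Submodule.equivMapOfInjective (linSubst M).toLinearMap
    (linSubst_injective hM) (linSys k n d s m p)).finrank_eq]
  refine Submodule.finrank_mono ?_
  rintro _ ⟨F, hF, rfl⟩
  obtain ⟨h1, h2⟩ := (mem_linSys_iff hp).1 hF
  refine (mem_linSys_iff hq).2 ⟨linSubst_isHomogeneous M h1, fun i hi => ?_⟩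
  rw [AlgHom.toLinearMap_apply, dirPow_linSubst, h i hi, dirPow_smul, h2 i hi, smul_zero,
    map_zero]

variable (k) in
/-- The coordinate points, followed by the point `(1 : ⋯ : 1)`. -/
def stdPt (n : ℕ) (i : ℕ) : Fin (n + 1) → k :=
  if h : i < n + 1 then Pi.single ⟨i, h⟩ 1 else 1

lemma stdPt_fin (n : ℕ) (i : Fin (n + 1)) : stdPt k n i = Pi.single i 1 := by
  rw [stdPt, dif_pos i.2]

lemma stdPt_last (n : ℕ) : stdPt k n (n + 1) = 1 := by
  simp [stdPt]

lemma stdPt_ne_zero (n i : ℕ) : stdPt k n i ≠ 0 := by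
  rw [stdPt]
  split_ifs <;> simp

lemma forall_lt_add_two {n : ℕ} {P : ℕ → Prop} :
    (∀ i < n + 2, P i) ↔ (∀ i : Fin (n + 1), P i) ∧ P (n + 1) := by
  refine ⟨fun h => ⟨fun i => h i (by omega), h _ (by omega)⟩, fun h i hi => ?_⟩
  rcases Nat.lt_succ_iff_lt_or_eq.1 hi with h' | rfl
  · exact h.1 ⟨i, h'⟩
  · exact h.2

/-- Points in linearly general position are projectively equivalent to the standard ones. -/
lemma exists_mulVec_stdPt {n : ℕ} {A : Matrix (Fin (n + 1)) (Fin (n + 1)) k}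
    {p : ℕ → (Fin (n + 1) → k)} (hA : ∀ j : Fin (n + 1), A.col j = p j) (hdet : A.det ≠ 0)
    (hcr : ∀ j, (A.updateCol j (p (n + 1))).det ≠ 0) :
    ∃ (M : Matrix (Fin (n + 1)) (Fin (n + 1)) k) (μ : ℕ → k), M.det ≠ 0 ∧
      ∀ i < n + 2, μ i ≠ 0 ∧ M.mulVec (stdPt k n i) = μ i • p i := by
  set l := A.cramer (p (n + 1)) with hl
  have hl0 (j) : l j ≠ 0 := by rw [hl, Matrix.cramer_apply]; exact hcr j
  refine ⟨A * Matrix.diagonal l, fun i => if h : i < n + 1 then l ⟨i, h⟩ else A.det, ?_, ?_⟩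
  · rw [Matrix.det_mul, Matrix.det_diagonal]
    exact mul_ne_zero hdet (Finset.prod_ne_zero_iff.2 fun j _ => hl0 j)
  · refine forall_lt_add_two.2 ⟨fun j => ?_, ?_⟩
    · beta_reduce
      rw [dif_pos j.2]
      refine ⟨hl0 j, ?_⟩
      rw [stdPt_fin, ← hA]
      ext i
      simp [mul_comm]
    · beta_reduce
      rw [dif_neg (lt_irrefl _)]
      refine ⟨hdet, ?_⟩
      rw [stdPt_last, ← Matrix.mulVec_mulVec]
      have : (Matrix.diagonal l).mulVec 1 = l := by
        ext i; simp [Matrix.mulVec_diagonal]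
      rw [this, hl, Matrix.mulVec_cramer]

lemma finrank_linSys_stdPt_le [CharZero k] {n d : ℕ} {m : ℕ → ℕ}
    {p : ℕ → (Fin (n + 1) → k)} (hp : ∀ i < n + 2, p i ≠ 0) :
    Module.finrank k (linSys k n d (n + 2) m (stdPt k n)) ≤
      Module.finrank k (linSys k n d (n + 2) m p) := by
  obtain ⟨Q, hQ, hle⟩ := exists_finrank_linSys_le (d := d) (m := m) hp (stdPt k n)
  let A : Matrix (Fin (n + 1)) (Fin (n + 1)) k := Matrix.of fun i j => p j i
  obtain ⟨P, hP, hPe⟩ := exists_eval_eq_det A 1 (by simp)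
  choose R hR hRe using fun j => exists_eval_eq_det (A.updateCol j (p (n + 1)))
    ((1 : Matrix (Fin (n + 1)) (Fin (n + 1)) k).updateCol j 1) (by
      rw [← Matrix.cramer_apply, Matrix.cramer_one]; simp)
  have hne : Q * P * ∏ j, R j ≠ 0 :=
    mul_ne_zero (mul_ne_zero hQ hP) (Finset.prod_ne_zero_iff.2 fun j _ => hR j)
  obtain ⟨t, ht⟩ : ∃ t, (Q * P * ∏ j, R j).eval t ≠ 0 := by
    by_contra! h
    exact hne (Polynomial.funext fun t => by simpa using h t)
  rw [Polynomial.eval_mul, Polynomial.eval_mul, Polynomial.eval_prod] at ht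
  have hQt := left_ne_zero_of_mul (left_ne_zero_of_mul ht)
  have hPt := right_ne_zero_of_mul (left_ne_zero_of_mul ht)
  have hRt (j) := Finset.prod_ne_zero_iff.1 (right_ne_zero_of_mul ht) j (Finset.mem_univ j)
  rw [hPe] at hPt
  obtain ⟨M, μ, hM, hμ⟩ := exists_mulVec_stdPt (A := A + t • 1) (p := p + t • stdPt k n)
    (fun j => by
      ext i
      simp [A, stdPt_fin, Pi.single_apply, Matrix.one_apply]) hPt (fun j => by
      have h := hRt j
      rw [hRe] at h
      convert h using 2
      ext a b
      by_cases hb : b = j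
      · subst hb; simp [stdPt_last]
      · simp [hb])
  have hu := isUnit_iff_ne_zero.2 hM
  have hne' : ∀ i < n + 2, p i + t • stdPt k n i ≠ 0 := by
    intro i hi h0
    have h1 := (hμ i hi).2
    rw [show (p + t • stdPt k n) i = 0 from h0, smul_zero] at h1
    exact stdPt_ne_zero n i (Matrix.eq_zero_of_mulVec_eq_zero hM h1)
  refine le_trans ?_ (hle t hQt hne')
  refine finrank_linSys_le_of_mulVec (M := M⁻¹) (μ := fun i => (μ i)⁻¹)
    (fun i _ => stdPt_ne_zero n i) hne' ?_ fun i hi => ?_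
  · exact (Matrix.isUnit_nonsing_inv_det M hu).ne_zero
  · rw [eq_inv_smul_iff₀ (hμ i hi).1, ← Matrix.mulVec_smul, ← (hμ i hi).2,
      Matrix.mulVec_mulVec, Matrix.nonsing_inv_mul _ hu, Matrix.one_mulVec]

lemma gdim_eq_stdPt [CharZero k] (n d : ℕ) (m : ℕ → ℕ) :
    gdim k n d (n + 2) m = Module.finrank k (linSys k n d (n + 2) m (stdPt k n)) := by
  refine le_antisymm (Nat.sInf_le ⟨stdPt k n, fun i _ => stdPt_ne_zero n i, rfl⟩) ?_
  refine le_csInf ⟨_, stdPt k n, fun i _ => stdPt_ne_zero n i, rfl⟩ ?_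
  rintro _ ⟨p, hp, rfl⟩
  exact finrank_linSys_stdPt_le hp

lemma linSys_eq_of_le {n d s : ℕ} {m m' : ℕ → ℕ} (hs : s ≤ n + 2)
    (hm : ∀ i < s, m' i = m i) (hm0 : ∀ i, s ≤ i → m' i = 0)
    {p p' : ℕ → (Fin (n + 1) → k)} (hp : ∀ i < s, p' i = p i) :
    linSys k n d (n + 2) m' p' = linSys k n d s m p := by
  ext F
  simp only [linSys, Submodule.mem_inf, Submodule.mem_iInf, Finset.mem_range,
    Submodule.restrictScalars_mem]
  refine and_congr_right fun _ => ⟨fun h i hi => ?_, fun h i _ => ?_⟩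
  · rw [← hm i hi, ← hp i hi]
    exact h i (by omega)
  · rcases lt_or_ge i s with hi | hi
    · rw [hm i hi, hp i hi]
      exact h i hi
    · simp [hm0 i hi]

lemma gdim_eq_of_le {n d s : ℕ} {m m' : ℕ → ℕ} (hs : s ≤ n + 2)
    (hm : ∀ i < s, m' i = m i) (hm0 : ∀ i, s ≤ i → m' i = 0) :
    gdim k n d s m = gdim k n d (n + 2) m' := by
  rw [gdim, gdim]
  congr 1
  ext N
  constructor
  · rintro ⟨p, hp, rfl⟩
    refine ⟨fun i => if i < s then p i else 1, fun i _ => ?_, ?_⟩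
    · dsimp only
      split_ifs with h
      · exact hp i h
      · exact one_ne_zero
    · rw [linSys_eq_of_le hs hm hm0 (p := p) fun i hi => by simp [hi]]
  · rintro ⟨p, hp, rfl⟩
    exact ⟨p, fun i hi => hp i (by omega), by
      rw [linSys_eq_of_le hs hm hm0 (p := p) fun i _ => rfl]⟩

lemma linSys_stdPt [CharZero k] {n d : ℕ} {m : ℕ → ℕ} (hm : ∀ i < n + 2, m i ≤ d) :
    linSys k n d (n + 2) m (stdPt k n) =
      boxForms k (fun i : Fin (n + 1) => d - m i) d ⊓
        LinearMap.ker (dirPow 1 (d + 1 - m (n + 1))) := by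
  ext F
  rw [mem_linSys_iff fun i _ => stdPt_ne_zero n i, forall_lt_add_two, Submodule.mem_inf,
    mem_boxForms, LinearMap.mem_ker, stdPt_last, ← and_assoc]
  refine and_congr_left fun _ => and_congr_right fun _ => ?_
  simp only [stdPt_fin, dirPow_single_eq_zero_iff]
  constructor
  · intro h x hx i
    have := h i x hx
    omega
  · intro h i x hx
    have := h x hx i
    have := hm i (by omega)
    omega

lemma card_boxSet_eq (n : ℕ) (c : ℕ → ℕ) (a : ℕ) :
    Nat.card (boxSet (fun i : Fin (n + 1) => c i) a) =
      (boundedExps n c (Finset.range (n + 1)) a).ncard := by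
  rw [Nat.card_coe_set_eq]
  congr 1
  ext x
  have h : ∀ i : Fin (n + 1), (i : ℕ) ∈ Finset.range (n + 1) := fun i => Finset.mem_range.2 i.2
  simp only [boxSet, boundedExps, Set.mem_ofPred_eq, Nat.cast_inj, h, forall_const]

end GenericPoints

/-- all non-empty linear systems with `s ≤ n+2` general points are
linearly non-special: if the generic dimension is at least `1`, it equals the linear
virtual dimension. -/
theorem stmt12 (k : Type) [Field k] [IsAlgClosed k] [CharZero k]
    (n d s : ℕ) (hn : 1 ≤ n) (hs1 : 1 ≤ s) (hs2 : s ≤ n + 2)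
    (m : ℕ → ℕ) (hne : 1 ≤ gdim k n d s m) :
    (gdim k n d s m : ℤ) = ldim n d s m := by
  set m' : ℕ → ℕ := fun i => if i < s then m i else 0 with hm'
  have hm : ∀ i < s, m' i = m i := fun i hi => by simp [hm', hi]
  have hm0 : ∀ i, s ≤ i → m' i = 0 := fun i hi => by simp [hm', hi]
  rw [gdim_eq_of_le hs2 hm hm0, gdim_eq_stdPt] at hne ⊢
  have hbot : linSys k n d (n + 2) m' (stdPt k n) ≠ ⊥ := by
    intro h
    rw [h, finrank_bot] at hne
    omega
  have hd2 : ∀ i < n + 2, m' i ≤ d := by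
    intro i hi
    by_contra! hlt
    refine hbot ((Submodule.eq_bot_iff _).2 fun F hF => ?_)
    have h := ((mem_linSys_iff fun i _ => stdPt_ne_zero n i).1 hF).2 i hi
    rwa [show d + 1 - m' i = 0 by omega, dirPow_zero] at h
  have hd : ∀ i, m' i ≤ d := fun i => by
    rcases lt_or_ge i (n + 2) with hi | hi
    · exact hd2 i hi
    · rw [hm0 i (by omega)]; omega
  rw [ldim_eq_of_le hs2 hm hm0 hd, ldim_eq hd2]
  rw [linSys_stdPt hd2] at hbot ⊢
  rcases Nat.eq_zero_or_pos (m' (n + 1)) with h0 | hpos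
  · have hle : boxForms k (fun i : Fin (n + 1) => d - m' i) d ≤
        LinearMap.ker (dirPow 1 (d + 1 - m' (n + 1))) := fun F hF =>
      LinearMap.mem_ker.2 (dirPow_eq_zero 1 (mem_boxForms.1 hF).1 (by omega))
    rw [inf_eq_left.2 hle, finrank_boxForms, card_boxSet_eq n (fun i => d - m' i),
      boundedExps_of_neg _ _ _ (show (m' (n + 1) : ℤ) - 1 < 0 by omega)]
    simp
  · have h := finrank_boxForms_inf_ker (k := k) _ (by omega) hbot
    rw [card_boxSet_eq n (fun i => d - m' i), card_boxSet_eq n (fun i => d - m' i)] at h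
    have he : ((d - (d + 1 - m' (n + 1)) : ℕ) : ℤ) = m' (n + 1) - 1 := by
      have := hd (n + 1)
      omega
    rw [he] at h
    omega
end
end
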